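/- arXiv:1609.03128 — 2 statements merged into one kernel-verified Lean document; each statement's English description precedes it below -/
import Mathlib

section
/- For every n ≥ 1, the type C_n zeta map ζ_C is a bijection from the set L_{n,n} of lattice paths with n East and n North steps onto the set B_{2n} of ballot paths of length 2n. -/
inductive Step
  | N : Step
  | E : Step
  deriving DecidableEq

/-- The number of East steps strictly preceding the `k`-th North step. -/
def ebn : List Step → ℕ → ℕ
  | _, 0 => 0
  | [], _ + 1 => 0
  | Step.E :: rest, k + 1 => ebn rest (k + 1) + 1
  | Step.N :: rest, k + 1 => ebn rest k

/-- A lattice path with `a` East steps and `b` North steps. -/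
def IsLatticePath (a b : ℕ) (π : List Step) : Prop :=
  π.count Step.E = a ∧ π.count Step.N = b

/-- A ballot path of length `m`: every prefix has at least as many `N`s as `E`s. -/
def IsBallotPath (m : ℕ) (β : List Step) : Prop :=
  β.length = m ∧ ∀ k : ℕ, (β.take k).count Step.E ≤ (β.take k).count Step.N

/-- `i` is a rise: the `i`-th North step is immediately followed by a North step. -/
def IsRise (π : List Step) (i : ℕ) : Prop :=
  ∃ p : ℕ, π[p]? = some Step.N ∧ π[p + 1]? = some Step.N ∧ (π.take p).count Step.N + 1 = i

/-- `(i,j)` is a valley: the `i`-th East step is immediately followed by the `j`-th North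
step; in addition if the path ends with an East step and consists of `i` East steps and
`j - 1` North steps, then `(i, j)` counts as a valley. -/
def IsValley (β : List Step) (i j : ℕ) : Prop :=
  (∃ p : ℕ, β[p]? = some Step.E ∧ β[p + 1]? = some Step.N ∧
      (β.take p).count Step.E + 1 = i ∧ (β.take (p + 1)).count Step.N + 1 = j) ∨
  (β.getLast? = some Step.E ∧ i = β.count Step.E ∧ j = β.count Step.N + 1)

/-- Read `a` from left to right, writing `N` for each entry `j` and `E` for each entry `j+1`. -/
def sPlusL (j : ℤ) (a : List ℤ) : List Step :=
  a.filterMap fun x => if x = j then some Step.N else if x = j + 1 then some Step.E else none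

/-- Read `a` from right to left, writing `N` for each entry `j` and `E` for each entry `j+1`. -/
def sPlusR (j : ℤ) (a : List ℤ) : List Step := sPlusL j a.reverse

/-- Read `a` from left to right, writing `N` for each entry `-j` and `E` for each entry `-j-1`. -/
def sMinusL (j : ℤ) (a : List ℤ) : List Step :=
  a.filterMap fun x => if x = -j then some Step.N else if x = -j - 1 then some Step.E else none

/-- Read `a` from right to left, writing `N` for each entry `-j` and `E` for each entry `-j-1`. -/
def sMinusR (j : ℤ) (a : List ℤ) : List Step := sMinusL j a.reverse

/-- The type `Cₙ` area vector of a lattice path, `μ k = (n+1-k) - λ_{n+1-k}` (1-based). -/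
def areaC (n : ℕ) (π : List Step) (k : ℕ) : ℤ :=
  ((n : ℤ) + 1 - k) - ebn π (n + 1 - k)

def areaCList (n : ℕ) (π : List Step) : List ℤ :=
  (List.range n).map fun k => areaC n π (k + 1)

/-- The type `Cₙ` zeta map. -/
def zetaC (n : ℕ) (π : List Step) : List Step :=
  ((List.range (n + 1)).reverse.map (fun j =>
    sMinusR (j : ℤ) (areaCList n π) ++ sPlusL (j : ℤ) (areaCList n π))).flatten


namespace ZetaC

theorem sPlusL_cons (j x : ℤ) (l : List ℤ) :
    sPlusL j (x :: l) =
      (if x = j then [Step.N] else if x = j + 1 then [Step.E] else []) ++ sPlusL j l := by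
  unfold sPlusL
  rw [List.filterMap_cons]
  split_ifs <;> simp

theorem sPlusL_reverse (j : ℤ) (l : List ℤ) : sPlusL j l.reverse = (sPlusL j l).reverse :=
  List.filterMap_reverse

theorem count_N_sPlusL (j : ℤ) (l : List ℤ) : (sPlusL j l).count Step.N = l.count j := by
  induction l with
  | nil => rfl
  | cons x l ih =>
    rw [sPlusL_cons, List.count_append, ih, List.count_cons]
    split_ifs <;> (simp_all; try omega)

theorem count_E_sPlusL (j : ℤ) (l : List ℤ) : (sPlusL j l).count Step.E = l.count (j + 1) := by
  induction l with
  | nil => rfl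
  | cons x l ih =>
    rw [sPlusL_cons, List.count_append, ih, List.count_cons]
    split_ifs <;> (simp_all; try omega)

theorem sPlusL_eq_nil {j : ℤ} {l : List ℤ} (h : ∀ x ∈ l, x < j) : sPlusL j l = [] := by
  refine List.filterMap_eq_nil_iff.2 fun x hx => ?_
  have := h x hx
  rw [if_neg (by omega), if_neg (by omega)]

theorem sMinusL_eq (j : ℤ) (l : List ℤ) : sMinusL j l = sPlusL j (l.map Neg.neg) := by
  unfold sMinusL sPlusL
  rw [List.filterMap_map]
  congr 1
  funext x
  simp only [Function.comp]
  congr 1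
  · exact propext (by omega)
  · congr 1
    exact propext (by omega)

/-- Integer lists that decrease by at most one at each step. -/
abbrev SlowDescent (l : List ℤ) : Prop := l.IsChain fun x y => x - 1 ≤ y

/-- The list read from right to left with all signs changed. -/
def negReverse (l : List ℤ) : List ℤ := (l.map Neg.neg).reverse

theorem SlowDescent.negReverse {l : List ℤ} (h : SlowDescent l) :
    SlowDescent (negReverse l) := by
  unfold SlowDescent ZetaC.negReverse
  rw [List.isChain_reverse, List.isChain_map]
  exact h.imp fun x y hxy => by omega

theorem sMinusR_eq (j : ℤ) (l : List ℤ) : sMinusR j l = sPlusL j (negReverse l) := by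
  rw [sMinusR, sMinusL_eq, negReverse, List.map_reverse]

/-- Exchange North and East steps. -/
def swap : Step → Step
  | Step.N => Step.E
  | Step.E => Step.N

theorem sPlusL_neg_sub_one (j : ℤ) (l : List ℤ) :
    sPlusL (-j - 1) l = ((sPlusL j (negReverse l)).map swap).reverse := by
  rw [negReverse, sPlusL_reverse, List.map_reverse, List.reverse_reverse]
  induction l with
  | nil => rfl
  | cons x l ih =>
    rw [List.map_cons, sPlusL_cons, sPlusL_cons, List.map_append, ih]
    congr 1
    split_ifs <;> first | omega | rfl

theorem sPlusL_not_end_E {j : ℤ} {l : List ℤ} (hl : SlowDescent l)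
    (hlast : ∀ x ∈ l.getLast?, x ≤ j) :
    (∀ u, sPlusL j l ≠ u ++ [Step.E]) ∧ ((∃ x ∈ l.head?, j ≤ x) → sPlusL j l ≠ []) := by
  induction l with
  | nil => simp [sPlusL]
  | cons x l ih =>
    rw [sPlusL_cons]
    cases l with
    | nil =>
      have : x ≤ j := by simpa using hlast
      simp only [sPlusL, List.filterMap_nil, List.append_nil]
      split_ifs with h1 h2
      · simp [List.singleton_eq_append_iff]
      · omega
      · simp
        omega
    | cons y l =>
      obtain ⟨h1, h2⟩ := List.isChain_cons_cons.1 hl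
      obtain ⟨ih1, ih2⟩ := ih h2 (by simpa using hlast)
      have ih3 : j ≤ y → sPlusL j (y :: l) ≠ [] := fun h => ih2 ⟨y, by simp, h⟩
      generalize sPlusL j (y :: l) = w at *
      have key : ∀ v : List Step, w ≠ [] → ∀ u, v ++ w ≠ u ++ [Step.E] := by
        intro v hw u h
        obtain ⟨w', s, rfl⟩ := List.eq_nil_or_concat w |>.resolve_left hw
        rw [List.concat_eq_append, ← List.append_assoc] at h
        have := List.append_inj_right' h rfl
        exact ih1 w' (by rw [List.concat_eq_append, this])
      split_ifs with c1 c2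
      · refine ⟨fun u => ?_, by simp⟩
        by_cases hw : w = []
        · subst hw
          simp [List.singleton_eq_append_iff]
        · exact key _ hw u
      · have hw := ih3 (by omega)
        exact ⟨key _ hw, by simp⟩
      · refine ⟨ih1, ?_⟩
        rintro ⟨z, hz, hjz⟩
        simp only [List.head?_cons, Option.mem_def, Option.some.injEq] at hz
        exact ih3 (by omega)

theorem sPlusL_not_start_N {j : ℤ} {l : List ℤ} (hl : SlowDescent l)
    (hhead : ∀ x ∈ l.head?, j < x) (u : List Step) : sPlusL j l ≠ Step.N :: u := by
  induction l with
  | nil => simp [sPlusL]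
  | cons x l ih =>
    have hx : j < x := hhead x (by simp)
    rw [sPlusL_cons, if_neg (by omega)]
    split_ifs with h
    · simp
    · refine ih hl.tail fun y hy => ?_
      obtain ⟨l', rfl⟩ : ∃ l', l = y :: l' := by
        cases l <;> simp_all
      have := (List.isChain_cons_cons.1 hl).1
      omega

theorem SlowDescent.eq_of_sPlusL_eq {a b : List ℤ} (ha : SlowDescent a) (hb : SlowDescent b)
    (h : ∀ j, sPlusL j a = sPlusL j b) : a = b := by
  induction a generalizing b with
  | nil =>
    cases b with
    | nil => rfl
    | cons y b =>
      have := h y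
      rw [sPlusL_cons, if_pos rfl] at this
      simp [sPlusL] at this
  | cons x a ih =>
    cases b with
    | nil =>
      have := h x
      rw [sPlusL_cons, if_pos rfl] at this
      simp [sPlusL] at this
    | cons y b =>
      rcases lt_trichotomy x y with hxy | rfl | hxy
      · have := h x
        rw [sPlusL_cons, if_pos rfl] at this
        exact absurd this.symm (sPlusL_not_start_N hb (by simpa using hxy) _)
      · refine congrArg _ (ih ha.tail hb.tail fun j => ?_)
        have := h j
        rw [sPlusL_cons, sPlusL_cons] at this
        exact List.append_cancel_left this
      · have := h y
        rw [sPlusL_cons y y, if_pos rfl] at this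
        exact absurd this (sPlusL_not_start_N ha (by simpa using hxy) _)

theorem append_inj_of_count_N {u v u' v' : List Step} (h : u ++ v = u' ++ v')
    (hu : ∀ w, u ≠ w ++ [Step.E]) (hu' : ∀ w, u' ≠ w ++ [Step.E])
    (hc : v.count Step.N = v'.count Step.N) : u = u' ∧ v = v' := by
  have key : ∀ u c : List Step, c.count Step.N = 0 → (∀ w, u ++ c ≠ w ++ [Step.E]) → c = [] := by
    intro u c hc hu
    rcases List.eq_nil_or_concat c with hc' | ⟨c', s, rfl⟩
    · exact hc'
    · cases s with
      | N => simp at hc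
      | E => exact absurd (by simp) (hu (u ++ c'))
  rcases List.append_eq_append_iff.1 h with ⟨c, rfl, rfl⟩ | ⟨c, rfl, rfl⟩
  · have := key u c (by simpa using hc) hu'
    subst this
    simp
  · have := key u' c (by simpa using hc.symm) hu
    subst this
    simp

/-- The part of the zeta word made of the `f` blocks at levels `k, …, k + f - 1`, from the
highest level to the lowest, for the lists `p` of negated and `q` of original entries. -/
def blocks (p q : List ℤ) : ℕ → ℕ → List Step
  | 0, _ => []
  | f + 1, k => blocks p q f (k + 1) ++ sPlusL k p ++ sPlusL k q

theorem blocks_eq_flatten (p q : List ℤ) (f k : ℕ) :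
    blocks p q f k =
      ((List.range' k f).reverse.map fun j : ℕ => sPlusL j p ++ sPlusL j q).flatten := by
  induction f generalizing k with
  | zero => rfl
  | succ f ih => simp [blocks, List.range'_succ, ih]

theorem zetaC_eq_blocks (n : ℕ) (π : List Step) :
    zetaC n π = blocks (negReverse (areaCList n π)) (areaCList n π) (n + 1) 0 := by
  rw [blocks_eq_flatten, zetaC, List.range_eq_range', List.bind_eq_flatMap]
  simp only [sMinusR_eq, List.pure_def, ← List.map_eq_flatMap, List.map_map, Function.comp_def]

theorem not_end_E_append {u v : List Step} (hu : ∀ w, u ≠ w ++ [Step.E])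
    (hv : ∀ w, v ≠ w ++ [Step.E]) (w : List Step) : u ++ v ≠ w ++ [Step.E] := by
  rcases List.eq_nil_or_concat v with rfl | ⟨v', s, rfl⟩
  · simpa using hu w
  · intro h
    rw [List.concat_eq_append, ← List.append_assoc] at h
    have := List.append_inj_right' h rfl
    exact hv v' (by rw [List.concat_eq_append, this])

theorem blocks_not_end_E {p q : List ℤ} (hp : SlowDescent p) (hq : SlowDescent q)
    (hp' : ∀ x ∈ p.getLast?, x ≤ 0) (hq' : ∀ x ∈ q.getLast?, x ≤ 1) (f k : ℕ) (w : List Step) :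
    blocks p q f (k + 1) ≠ w ++ [Step.E] := by
  induction f generalizing k w with
  | zero => simp [blocks]
  | succ f ih =>
    refine not_end_E_append (not_end_E_append (ih _) ?_) ?_ w
    · exact (sPlusL_not_end_E hp fun x hx => (hp' x hx).trans (by positivity)).1
    · exact (sPlusL_not_end_E hq fun x hx => (hq' x hx).trans (by push_cast; omega)).1

theorem sPlusL_eq_of_blocks_eq {p q p' q' : List ℤ}
    (hp : SlowDescent p) (hq : SlowDescent q)
    (hp0 : ∀ x ∈ p.getLast?, x ≤ 0) (hq1 : ∀ x ∈ q.getLast?, x ≤ 1)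
    (hp' : SlowDescent p') (hq' : SlowDescent q')
    (hp0' : ∀ x ∈ p'.getLast?, x ≤ 0) (hq1' : ∀ x ∈ q'.getLast?, x ≤ 1)
    {f k : ℕ} (h : blocks p q f k = blocks p' q' f k)
    (hcp : p.count (k : ℤ) = p'.count (k : ℤ)) (hcq : q.count (k : ℤ) = q'.count (k : ℤ)) :
    ∀ j, k ≤ j → j < k + f →
      sPlusL j p = sPlusL j p' ∧ sPlusL j q = sPlusL j q' := by
  induction f generalizing k with
  | zero => intros; omega
  | succ f ih =>
    have e := blocks_not_end_E hp hq hp0 hq1 f k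
    have e' := blocks_not_end_E hp' hq' hp0' hq1' f k
    have e1 := (sPlusL_not_end_E (j := k) hp fun x hx => (hp0 x hx).trans (by positivity)).1
    have e1' := (sPlusL_not_end_E (j := k) hp' fun x hx => (hp0' x hx).trans (by positivity)).1
    obtain ⟨h1, h2⟩ := append_inj_of_count_N h (not_end_E_append e e1) (not_end_E_append e' e1')
      (by rw [count_N_sPlusL, count_N_sPlusL, hcq])
    obtain ⟨h3, h4⟩ := append_inj_of_count_N h1 e e'
      (by rw [count_N_sPlusL, count_N_sPlusL, hcp])
    intro j hkj hjf
    rcases hkj.eq_or_lt with rfl | hlt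
    · exact ⟨h4, h2⟩
    · refine ih h3 ?_ ?_ j hlt (by omega)
      · have := congrArg (List.count Step.E) h4
        rw [count_E_sPlusL, count_E_sPlusL] at this
        exact_mod_cast this
      · have := congrArg (List.count Step.E) h2
        rw [count_E_sPlusL, count_E_sPlusL] at this
        exact_mod_cast this

theorem count_N_blocks {p q : List ℤ} {f k : ℕ}
    (hp : ∀ x ∈ p, x < k + f) (hq : ∀ x ∈ q, x < k + f) :
    (blocks p q f k).count Step.N =
      p.countP (fun x => (k : ℤ) ≤ x) + q.countP (fun x => (k : ℤ) ≤ x) := by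
  have split : ∀ (l : List ℤ) (j : ℤ),
      l.countP (fun x => j ≤ x) = l.count j + l.countP (fun x => j + 1 ≤ x) := by
    intro l j
    induction l with
    | nil => rfl
    | cons x l ih =>
      simp only [List.countP_cons, List.count_cons, ih, decide_eq_true_eq, beq_iff_eq]
      split_ifs <;> omega
  induction f generalizing k with
  | zero =>
    have : ∀ l : List ℤ, (∀ x ∈ l, x < (k : ℤ) + (0 : ℕ)) →
        l.countP (fun x => (k : ℤ) ≤ x) = 0 := by
      intro l hl
      refine List.countP_eq_zero.2 fun x hx => ?_
      have := hl x hx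
      simp only [decide_eq_true_eq]
      omega
    rw [this p hp, this q hq]
    rfl
  | succ f ih =>
    rw [blocks, List.count_append, List.count_append, ih
      (fun x hx => by have := hp x hx; push_cast at this ⊢; omega)
      (fun x hx => by have := hq x hx; push_cast at this ⊢; omega),
      count_N_sPlusL, count_N_sPlusL, split p k, split q k]
    push_cast
    ring

theorem count_E_blocks {p q : List ℤ} {f k : ℕ}
    (hp : ∀ x ∈ p, x < k + f) (hq : ∀ x ∈ q, x < k + f) :
    (blocks p q f k).count Step.E + p.count (k : ℤ) + q.count (k : ℤ) =
      (blocks p q f k).count Step.N := by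
  induction f generalizing k with
  | zero =>
    have h1 : (k : ℤ) ∉ p := fun h => by simpa using hp _ h
    have h2 : (k : ℤ) ∉ q := fun h => by simpa using hq _ h
    rw [List.count_eq_zero.2 h1, List.count_eq_zero.2 h2]
    rfl
  | succ f ih =>
    have := @ih (k + 1)
      (fun x hx => by have := hp x hx; push_cast at this ⊢; omega)
      (fun x hx => by have := hq x hx; push_cast at this ⊢; omega)
    simp only [blocks, List.count_append, count_N_sPlusL, count_E_sPlusL]
    push_cast at this
    omega

/-- `w` stays weakly above `0` when started at height `h`. -/
def StaysAbove (h : ℕ) (w : List Step) : Prop :=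
  ∀ k : ℕ, (w.take k).count Step.E ≤ h + (w.take k).count Step.N

theorem StaysAbove.append {u v : List Step} (hu : StaysAbove 0 u)
    (h : u.count Step.E + v.count Step.E ≤ u.count Step.N) : StaysAbove 0 (u ++ v) := by
  intro k
  rw [List.take_append, List.count_append, List.count_append]
  have h1 := hu k
  have h2 : (v.take (k - u.length)).count Step.E ≤ v.count Step.E :=
    (List.take_sublist _ _).count_le _
  rcases le_total k u.length with hk | hk
  · simp only [Nat.sub_eq_zero_of_le hk, List.take_zero, List.count_nil]
    omega
  · rw [List.take_of_length_le hk]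
    omega

theorem staysAbove_blocks {p q : List ℤ} {f k : ℕ}
    (hp : ∀ x ∈ p, x < k + f) (hq : ∀ x ∈ q, x < k + f) :
    StaysAbove 0 (blocks p q f k) := by
  induction f generalizing k with
  | zero => simp [blocks, StaysAbove]
  | succ f ih =>
    have hp' : ∀ x ∈ p, x < ((k + 1 : ℕ) : ℤ) + f :=
      fun x hx => by have := hp x hx; push_cast at this ⊢; omega
    have hq' : ∀ x ∈ q, x < ((k + 1 : ℕ) : ℤ) + f :=
      fun x hx => by have := hq x hx; push_cast at this ⊢; omega
    rw [blocks, List.append_assoc]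
    refine (ih hp' hq').append ?_
    have := count_E_blocks hp' hq'
    rw [List.count_append, count_E_sPlusL, count_E_sPlusL]
    push_cast at this
    omega

/-- The number of words of length `m` satisfying `P`. -/
noncomputable def numWords (m : ℕ) (P : List Step → Prop) : ℕ :=
  {w : List Step | w.length = m ∧ P w}.ncard

instance : Fintype Step := ⟨{Step.N, Step.E}, fun s => by cases s <;> decide⟩

theorem finite_words (m : ℕ) (P : List Step → Prop) :
    {w : List Step | w.length = m ∧ P w}.Finite :=
  (List.finite_length_eq Step m).subset fun _ hw => hw.1

theorem numWords_zero (P : List Step → Prop) [Decidable (P [])] :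
    numWords 0 P = if P [] then 1 else 0 := by
  unfold numWords
  split_ifs with h
  · rw [Set.ncard_eq_one]
    refine ⟨[], Set.ext fun w => ?_⟩
    simp only [List.length_eq_zero_iff, Set.mem_ofPred_eq, Set.mem_singleton_iff]
    exact ⟨fun hw => hw.1, fun hw => ⟨hw, hw ▸ h⟩⟩
  · rw [Set.ncard_eq_zero (finite_words 0 P)]
    refine Set.eq_empty_of_forall_notMem fun w hw => h ?_
    rw [← List.length_eq_zero_iff.1 hw.1]
    exact hw.2

theorem numWords_congr {m : ℕ} {P Q : List Step → Prop} (h : ∀ w, w.length = m → (P w ↔ Q w)) :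
    numWords m P = numWords m Q := by
  unfold numWords
  congr 1
  ext w
  exact and_congr_right (h w)

theorem numWords_eq_zero {m : ℕ} {P : List Step → Prop} (h : ∀ w, ¬ P w) : numWords m P = 0 := by
  rw [numWords, Set.ncard_eq_zero (finite_words m P)]
  exact Set.eq_empty_of_forall_notMem fun w hw => h w hw.2

theorem numWords_or {m : ℕ} {P Q : List Step → Prop} (h : ∀ w, P w → ¬ Q w) :
    numWords m (fun w => P w ∨ Q w) = numWords m P + numWords m Q := by
  unfold numWords
  rw [← Set.ncard_union_eq _ (finite_words m P) (finite_words m Q)]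
  · congr 1
    ext w
    exact and_or_left
  · exact Set.disjoint_left.2 fun w hw hw' => h w hw.2 hw'.2

theorem numWords_succ (m : ℕ) (P : List Step → Prop) :
    numWords (m + 1) P =
      numWords m (fun w => P (Step.N :: w)) + numWords m (fun w => P (Step.E :: w)) := by
  unfold numWords
  rw [← Set.ncard_image_of_injective {w | w.length = m ∧ P (Step.N :: w)}
      (List.cons_injective (a := Step.N)),
    ← Set.ncard_image_of_injective {w | w.length = m ∧ P (Step.E :: w)}
      (List.cons_injective (a := Step.E)),
    ← Set.ncard_union_eq _ ((finite_words m _).image _) ((finite_words m _).image _)]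
  · congr 1
    ext w
    rcases w with _ | ⟨_ | _, w⟩ <;> simp
  · rw [Set.disjoint_left]
    rintro _ ⟨w, _, rfl⟩ ⟨w', _, h⟩
    simp at h

theorem staysAbove_N_cons (h : ℕ) (w : List Step) :
    StaysAbove h (Step.N :: w) ↔ StaysAbove (h + 1) w := by
  constructor
  · intro H k
    have := H (k + 1)
    simp at this
    omega
  · intro H k
    cases k with
    | zero => simp
    | succ k =>
      have := H k
      simp
      omega

theorem staysAbove_succ_E_cons (h : ℕ) (w : List Step) :
    StaysAbove (h + 1) (Step.E :: w) ↔ StaysAbove h w := by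
  constructor
  · intro H k
    have := H (k + 1)
    simp at this
    omega
  · intro H k
    cases k with
    | zero => simp
    | succ k =>
      have := H k
      simp
      omega

theorem not_staysAbove_zero_E_cons (w : List Step) : ¬ StaysAbove 0 (Step.E :: w) := by
  intro H
  have := H 1
  simp at this

/-- The difference between the numbers of North and East steps is at most `t`. -/
def EndsBelow (t : ℤ) (w : List Step) : Prop := (w.count Step.N : ℤ) ≤ t + w.count Step.E

theorem numWords_endsBelow_succ (m : ℕ) (t : ℤ) :
    numWords (m + 1) (EndsBelow t) =
      numWords m (EndsBelow (t - 1)) + numWords m (EndsBelow (t + 1)) := by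
  rw [numWords_succ]
  congr 1 <;>
  · refine numWords_congr fun w _ => ?_
    simp [EndsBelow]
    omega

theorem numWords_staysAbove (m h : ℕ) :
    numWords m (StaysAbove h) + numWords m (EndsBelow (-h - 1)) =
      numWords m (EndsBelow (h + 1)) := by
  classical
  induction m generalizing h with
  | zero =>
    rw [numWords_zero, numWords_zero, numWords_zero, if_pos (by simp [StaysAbove]),
      if_neg (by simp [EndsBelow]; omega), if_pos (by simp [EndsBelow]; omega)]
  | succ m ih =>
    rw [numWords_endsBelow_succ, numWords_endsBelow_succ, numWords_succ]
    simp only [staysAbove_N_cons]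
    have h1 : numWords m (fun w => StaysAbove (h + 1) w) + _ = _ := ih (h + 1)
    rw [show (-((h + 1 : ℕ) : ℤ) - 1) = -h - 1 - 1 by push_cast; ring,
      show (((h + 1 : ℕ) : ℤ) + 1) = h + 1 + 1 by push_cast; ring] at h1
    cases h with
    | zero =>
      rw [numWords_eq_zero not_staysAbove_zero_E_cons]
      simp only [Nat.cast_zero, neg_zero, zero_sub, zero_add] at h1 ⊢
      norm_num at h1 ⊢
      omega
    | succ h =>
      simp only [staysAbove_succ_E_cons]
      have h2 : numWords m (fun w => StaysAbove h w) + _ = _ := ih h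
      rw [show (-((h + 1 : ℕ) : ℤ) - 1 + 1) = -h - 1 by push_cast; ring,
        show (((h + 1 : ℕ) : ℤ) + 1 - 1) = h + 1 by push_cast; ring]
      omega

theorem count_N_add_count_E (w : List Step) : w.count Step.N + w.count Step.E = w.length := by
  induction w with
  | nil => rfl
  | cons s w ih => cases s <;> simp <;> omega

theorem isLatticePath_iff (n : ℕ) (w : List Step) :
    IsLatticePath n n w ↔ w.length = 2 * n ∧ w.count Step.N = w.count Step.E := by
  have := count_N_add_count_E w
  unfold IsLatticePath
  omega

theorem isBallotPath_iff (m : ℕ) (w : List Step) :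
    IsBallotPath m w ↔ w.length = m ∧ StaysAbove 0 w := by
  simp [IsBallotPath, StaysAbove]

theorem ncard_ballotPaths (n : ℕ) :
    {β : List Step | IsBallotPath (2 * n) β}.ncard =
      {π : List Step | IsLatticePath n n π}.ncard := by
  have h1 := numWords_staysAbove (2 * n) 0
  have h2 : numWords (2 * n) (EndsBelow ((0 : ℕ) + 1)) =
      numWords (2 * n) fun w => w.count Step.N = w.count Step.E ∨ EndsBelow (-(0 : ℕ) - 1) w := by
    refine numWords_congr fun w hw => ?_
    have := count_N_add_count_E w
    simp only [EndsBelow]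
    omega
  rw [numWords_or fun w hw => by simp only [EndsBelow]; omega] at h2
  simp only [isBallotPath_iff, isLatticePath_iff]
  change numWords _ _ = numWords _ _
  omega

theorem ebn_le_count (π : List Step) (k : ℕ) : ebn π k ≤ π.count Step.E := by
  induction π generalizing k with
  | nil => cases k <;> simp [ebn]
  | cons s π ih =>
    cases k with
    | zero => simp [ebn]
    | succ k =>
      cases s
      · simpa [ebn] using ih k
      · simpa [ebn] using ih (k + 1)

theorem ebn_le_ebn_succ (π : List Step) (k : ℕ) : ebn π k ≤ ebn π (k + 1) := by
  induction π generalizing k with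
  | nil => cases k <;> simp [ebn]
  | cons s π ih =>
    cases k with
    | zero => simp [ebn]
    | succ k =>
      cases s
      · simpa [ebn] using ih k
      · simpa [ebn] using ih (k + 1)

theorem eq_of_ebn_eq {a b : ℕ} {π π' : List Step} (h : IsLatticePath a b π)
    (h' : IsLatticePath a b π') (he : ∀ k < b, ebn π (k + 1) = ebn π' (k + 1)) : π = π' := by
  induction π generalizing a b π' with
  | nil =>
    have := count_N_add_count_E π'
    obtain ⟨rfl, rfl⟩ := h
    obtain ⟨h1, h2⟩ := h'
    rw [h1, h2] at this
    exact (List.length_eq_zero_iff.1 (by simpa using this.symm)).symm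
  | cons s π ih =>
    obtain ⟨rfl, rfl⟩ := h
    cases π' with
    | nil =>
      obtain ⟨h1, h2⟩ := h'
      cases s <;> simp at h1 h2
    | cons s' π' =>
      obtain ⟨h1, h2⟩ := h'
      cases s <;> cases s'
      · simp only [List.count_cons_self, ne_eq, reduceCtorEq, not_false_eq_true,
          List.count_cons_of_ne, Nat.add_right_cancel_iff] at h1 h2 he
        refine congrArg _ (ih ⟨rfl, rfl⟩ ⟨h1, h2⟩ fun k hk => ?_)
        simpa [ebn] using he (k + 1) (by omega)
      · have := he 0 (by simp)
        simp [ebn] at this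
      · have := he 0 (by rw [← h2]; simp)
        simp [ebn] at this
      · simp only [List.count_cons_self, ne_eq, reduceCtorEq, not_false_eq_true,
          List.count_cons_of_ne, Nat.add_right_cancel_iff] at h1 h2 he
        refine congrArg _ (ih ⟨rfl, rfl⟩ ⟨h1, h2⟩ fun k hk => ?_)
        simpa [ebn] using he k hk

theorem slowDescent_areaCList (n : ℕ) (π : List Step) : SlowDescent (areaCList n π) := by
  unfold SlowDescent areaCList
  rw [List.isChain_iff_getElem]
  intro i hi
  simp only [List.length_map, List.length_range] at hi
  simp only [List.getElem_map, List.getElem_range, areaC]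
  have := ebn_le_ebn_succ π (n - (i + 1))
  rw [show n + 1 - (i + 1) = n - (i + 1) + 1 by omega,
    show n + 1 - (i + 1 + 1) = n - (i + 1) by omega]
  push_cast
  omega

theorem mem_areaCList {n : ℕ} {π : List Step} (hπ : IsLatticePath n n π) {x : ℤ}
    (hx : x ∈ areaCList n π) : -n ≤ x ∧ x ≤ n := by
  obtain ⟨k, hk, rfl⟩ := List.mem_map.1 hx
  rw [List.mem_range] at hk
  have := ebn_le_count π (n + 1 - (k + 1))
  rw [hπ.1] at this
  unfold areaC
  generalize ebn π (n + 1 - (k + 1)) = e at this ⊢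
  push_cast
  omega

theorem getLast_areaCList_le {n : ℕ} {π : List Step} {x : ℤ}
    (hx : x ∈ (areaCList n π).getLast?) : x ≤ 1 := by
  cases n with
  | zero => simp [areaCList] at hx
  | succ n =>
    rw [areaCList, List.range_succ, List.map_append] at hx
    simp only [List.map_cons, List.map_nil, List.getLast?_append_cons, List.getLast?_singleton,
      Option.mem_def, Option.some.injEq, areaC] at hx
    push_cast at hx
    omega

theorem getLast_negReverse_areaCList_le {n : ℕ} {π : List Step} (hπ : IsLatticePath n n π) {x : ℤ}
    (hx : x ∈ (negReverse (areaCList n π)).getLast?) : x ≤ 0 := by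
  cases n with
  | zero => simp [areaCList, negReverse] at hx
  | succ n =>
    rw [negReverse, List.getLast?_reverse, areaCList, List.range_succ_eq_map] at hx
    simp only [List.map_cons, List.head?_cons, Option.mem_def, Option.some.injEq, areaC] at hx
    have := ebn_le_count π (n + 1 + 1 - (0 + 1))
    rw [hπ.1] at this
    generalize ebn π (n + 1 + 1 - (0 + 1)) = e at this hx
    push_cast at hx
    omega

theorem length_areaCList (n : ℕ) (π : List Step) : (areaCList n π).length = n := by
  simp [areaCList]

theorem mem_negReverse {l : List ℤ} {x : ℤ} : x ∈ negReverse l ↔ -x ∈ l := by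
  simp only [negReverse, List.mem_reverse, List.mem_map]
  exact ⟨by rintro ⟨y, hy, rfl⟩; simpa using hy, fun h => ⟨_, h, neg_neg x⟩⟩

theorem count_zero_negReverse (l : List ℤ) : (negReverse l).count 0 = l.count 0 := by
  rw [negReverse, List.count_reverse]
  simpa using List.count_map_of_injective l _ neg_injective 0

theorem countP_nonneg_add_countP_nonneg_negReverse (l : List ℤ) :
    (negReverse l).countP (fun x => 0 ≤ x) + l.countP (fun x => 0 ≤ x) =
      l.length + l.count 0 := by
  rw [negReverse, List.countP_reverse, List.countP_map]
  induction l with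
  | nil => rfl
  | cons x l ih =>
    simp only [List.countP_cons, List.count_cons, List.length_cons, decide_eq_true_eq, beq_iff_eq, Function.comp_def] at ih ⊢
    split_ifs <;> omega

theorem areaCList_lt {n : ℕ} {π : List Step} (hπ : IsLatticePath n n π) :
    ∀ x ∈ areaCList n π, x < ((0 : ℕ) : ℤ) + ((n + 1 : ℕ) : ℤ) := fun x hx => by
  have := mem_areaCList hπ hx
  push_cast
  omega

theorem negReverse_areaCList_lt {n : ℕ} {π : List Step} (hπ : IsLatticePath n n π) :
    ∀ x ∈ negReverse (areaCList n π), x < ((0 : ℕ) : ℤ) + ((n + 1 : ℕ) : ℤ) := fun x hx => by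
  have := mem_areaCList hπ (mem_negReverse.1 hx)
  push_cast
  omega

theorem counts_zetaC {n : ℕ} {π : List Step} (hπ : IsLatticePath n n π) :
    (zetaC n π).count Step.N = n + (areaCList n π).count 0 ∧
      (zetaC n π).count Step.E + (areaCList n π).count 0 = n := by
  have hp := negReverse_areaCList_lt hπ
  have hq := areaCList_lt hπ
  have h1 := count_N_blocks hp hq
  have h2 := count_E_blocks hp hq
  have h3 := countP_nonneg_add_countP_nonneg_negReverse (areaCList n π)
  rw [Nat.cast_zero, count_zero_negReverse] at h2
  rw [Nat.cast_zero, h3, length_areaCList] at h1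
  rw [zetaC_eq_blocks]
  omega

theorem isBallotPath_zetaC {n : ℕ} {π : List Step} (hπ : IsLatticePath n n π) :
    IsBallotPath (2 * n) (zetaC n π) := by
  rw [isBallotPath_iff]
  constructor
  · have := counts_zetaC hπ
    rw [← count_N_add_count_E]
    omega
  · rw [zetaC_eq_blocks]
    exact staysAbove_blocks (negReverse_areaCList_lt hπ) (areaCList_lt hπ)

theorem areaCList_eq_of_zetaC_eq {n : ℕ} {π π' : List Step} (hπ : IsLatticePath n n π)
    (hπ' : IsLatticePath n n π') (h : zetaC n π = zetaC n π') :
    areaCList n π = areaCList n π' := by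
  have hs := slowDescent_areaCList n π
  have hs' := slowDescent_areaCList n π'
  have hc : (areaCList n π).count 0 = (areaCList n π').count 0 := by
    have h1 := (counts_zetaC hπ).1
    have h2 := (counts_zetaC hπ').1
    rw [h] at h1
    omega
  rw [zetaC_eq_blocks, zetaC_eq_blocks] at h
  have key := sPlusL_eq_of_blocks_eq hs.negReverse hs
    (fun _ => getLast_negReverse_areaCList_le hπ) (fun _ => getLast_areaCList_le)
    hs'.negReverse hs' (fun _ => getLast_negReverse_areaCList_le hπ')
    (fun _ => getLast_areaCList_le) h
    (by rw [Nat.cast_zero, count_zero_negReverse, count_zero_negReverse, hc])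
    (by rw [Nat.cast_zero, hc])
  have nonneg : ∀ j : ℕ,
      sPlusL j (negReverse (areaCList n π)) = sPlusL j (negReverse (areaCList n π')) ∧
        sPlusL j (areaCList n π) = sPlusL j (areaCList n π') := by
    intro j
    rcases lt_or_ge j (0 + (n + 1)) with hj | hj
    · exact key j (Nat.zero_le j) hj
    · have hj' : ((0 : ℕ) : ℤ) + ((n + 1 : ℕ) : ℤ) ≤ j := by exact_mod_cast hj
      constructor
      · rw [sPlusL_eq_nil fun x hx => (negReverse_areaCList_lt hπ x hx).trans_le hj',
          sPlusL_eq_nil fun x hx => (negReverse_areaCList_lt hπ' x hx).trans_le hj']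
      · rw [sPlusL_eq_nil fun x hx => (areaCList_lt hπ x hx).trans_le hj',
          sPlusL_eq_nil fun x hx => (areaCList_lt hπ' x hx).trans_le hj']
  refine hs.eq_of_sPlusL_eq hs' fun j => ?_
  rcases le_or_gt 0 j with hj | hj
  · lift j to ℕ using hj
    exact (nonneg j).2
  · obtain ⟨i, hi⟩ := Int.eq_ofNat_of_zero_le (a := -j - 1) (by omega)
    rw [show j = -(i : ℤ) - 1 by omega, sPlusL_neg_sub_one, sPlusL_neg_sub_one, (nonneg i).1]

theorem injOn_zetaC (n : ℕ) : Set.InjOn (zetaC n) {π : List Step | IsLatticePath n n π} := by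
  intro π hπ π' hπ' h
  have he := areaCList_eq_of_zetaC_eq hπ hπ' h
  refine eq_of_ebn_eq hπ hπ' fun k hk => ?_
  have := List.map_inj_left.1 he (n - (k + 1)) (List.mem_range.2 (by omega))
  unfold areaC at this
  rw [show n + 1 - (n - (k + 1) + 1) = k + 1 by omega] at this
  omega

theorem finite_ballotPaths (m : ℕ) : {β : List Step | IsBallotPath m β}.Finite :=
  (List.finite_length_eq Step m).subset fun _ h => h.1

end ZetaC

/-- For every `n ≥ 1`, the type `Cₙ` zeta map is a bijection from lattice
paths in `L_{n,n}` onto ballot paths of length `2n`. -/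
theorem zetaC_bijOn (n : ℕ) (hn : 1 ≤ n) :
    Set.BijOn (zetaC n) {π : List Step | IsLatticePath n n π}
      {β : List Step | IsBallotPath (2 * n) β} := by
  have hmaps : Set.MapsTo (zetaC n) {π : List Step | IsLatticePath n n π}
      {β : List Step | IsBallotPath (2 * n) β} := fun _ hπ => ZetaC.isBallotPath_zetaC hπ
  have hinj := ZetaC.injOn_zetaC n
  refine ⟨hmaps, hinj, (Set.eq_of_subset_of_ncard_le hmaps.image_subset ?_
    (ZetaC.finite_ballotPaths (2 * n))).ge⟩
  rw [hinj.ncard_image, ZetaC.ncard_ballotPaths]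
end

section
/- For every n ≥ 1, the Haglund–Loehr zeta map of type C_n, sending (π,u) to (ζ_C(π), d_C(π,u)), is a bijection from Vert(C_n) onto Diag(C_n). -/
/-- `w` is the window `[w(1),…,w(n)]` of a signed permutation of rank `n`. -/
def IsSignedPerm (n : ℕ) (w : Fin n → ℤ) : Prop :=
  (∀ i, 1 ≤ |w i| ∧ |w i| ≤ (n : ℤ)) ∧ Function.Injective fun i => |w i|

/-- Evaluation of (the window of) a signed permutation at any integer, via `w(-j) = -w(j)`
and `w(0) = 0`. -/
def evalSP {n : ℕ} (w : Fin n → ℤ) (j : ℤ) : ℤ :=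
  if h : 1 ≤ j ∧ j ≤ (n : ℤ) then w ⟨(j - 1).toNat, by omega⟩
  else if h' : 1 ≤ -j ∧ -j ≤ (n : ℤ) then -w ⟨(-j - 1).toNat, by omega⟩
  else 0

/-- Vertically labelled lattice paths of type `Cₙ` (also of type `Bₙ`). -/
def VertC (n : ℕ) : Set (List Step × (Fin n → ℤ)) :=
  {p : List Step × (Fin n → ℤ) | IsLatticePath n n p.1 ∧ IsSignedPerm n p.2 ∧
    (∀ i : ℕ, IsRise p.1 i → evalSP p.2 (i : ℤ) < evalSP p.2 ((i : ℤ) + 1)) ∧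
    (p.1.head? = some Step.N → 0 < evalSP p.2 1)}

/-- Diagonally labelled ballot paths of type `Cₙ`. -/
def DiagC (n : ℕ) : Set (List Step × (Fin n → ℤ)) :=
  {p : List Step × (Fin n → ℤ) | IsBallotPath (2 * n) p.1 ∧ IsSignedPerm n p.2 ∧
    ∀ i j : ℕ, IsValley p.1 i j →
      (j ≤ n → evalSP p.2 ((n : ℤ) + 1 - j) < evalSP p.2 ((n : ℤ) + 1 - i)) ∧
      (n < j → evalSP p.2 ((n : ℤ) - j) < evalSP p.2 ((n : ℤ) + 1 - i))}

/-- The diagonal reading word of type `Cₙ` as the list of its window entries. -/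
def dCList (n : ℕ) (π : List Step) (w : Fin n → ℤ) : List ℤ :=
  ((List.range (n + 1)).map (fun i =>
    ((List.finRange n).reverse.filterMap (fun j =>
      if areaC n π (n - j.val) = -(i : ℤ) then some (-(w j)) else none)) ++
    ((List.finRange n).filterMap (fun j =>
      if areaC n π (n - j.val) = (i : ℤ) + 1 then some (w j) else none)))).flatten

/-- The diagonal reading word of type `Cₙ`. -/
def dC (n : ℕ) (π : List Step) (w : Fin n → ℤ) : Fin n → ℤ :=
  fun i => (dCList n π w).getD i.val 0


/-- The concatenation `B (j + k - 1) ++ ⋯ ++ B (j + 1) ++ B j`. -/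
def descFlatten {α : Type*} (B : ℕ → List α) : ℕ → ℕ → List α
  | 0, _ => []
  | k + 1, j => descFlatten B k (j + 1) ++ B j

/-- The entries of value `j` and `j + 1` of a labelled sequence, marked by `N` and `E`. -/
def labelledBlock (j : ℤ) (l : List (ℤ × ℤ)) : List (Step × ℤ) :=
  l.filterMap fun p =>
    if p.1 = j then some (Step.N, p.2) else if p.1 = j + 1 then some (Step.E, p.2) else none

/-- The labels of the entries of value `v` of a labelled sequence. -/
def level (v : ℤ) (l : List (ℤ × ℤ)) : List ℤ :=
  l.filterMap fun p => if p.1 = v then some p.2 else none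

/-- The labels of the letters `s` of a labelled word. -/
def stepLabels (s : Step) (L : List (Step × ℤ)) : List ℤ :=
  L.filterMap fun p => if p.1 = s then some p.2 else none

theorem isInfix_reverse_iff {α : Type*} {l₁ l₂ : List α} :
    l₁.reverse <:+: l₂.reverse ↔ l₁ <:+: l₂ := by
  simp

section descFlatten

variable {α β : Type*}

theorem flatten_reverse_range_map (B : ℕ → List α) (k j : ℕ) :
    (((List.range k).reverse.map fun i => B (i + j)).flatten) = descFlatten B k j := by
  induction k generalizing j with
  | zero => simp [descFlatten]
  | succ k ih =>
    rw [List.range_succ_eq_map, descFlatten, ← ih (j + 1)]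
    simp [List.map_reverse, Function.comp_def, Nat.add_right_comm, Nat.add_assoc]

theorem map_descFlatten (f : α → β) (B : ℕ → List α) (k j : ℕ) :
    (descFlatten B k j).map f = descFlatten (fun i => (B i).map f) k j := by
  induction k generalizing j with
  | zero => simp [descFlatten]
  | succ k ih => simp [descFlatten, ih]

theorem filterMap_descFlatten (f : α → Option β) (B : ℕ → List α) (k j : ℕ) :
    (descFlatten B k j).filterMap f = descFlatten (fun i => (B i).filterMap f) k j := by
  induction k generalizing j with
  | zero => simp [descFlatten]
  | succ k ih => simp [descFlatten, ih]

theorem descFlatten_shift (R M : ℕ → List α) (k j : ℕ) :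
    descFlatten (fun i => R (i + 1) ++ M i) k j ++ R j =
      R (j + k) ++ descFlatten (fun i => M i ++ R i) k j := by
  induction k generalizing j with
  | zero => simp [descFlatten]
  | succ k ih =>
    have := ih (j + 1)
    simp only [descFlatten, ← List.append_assoc] at this ⊢
    rw [this, Nat.add_right_comm, Nat.add_assoc]

theorem getLast?_descFlatten {P : α → Prop} (B : ℕ → List α) (k j : ℕ)
    (h : ∀ i, j ≤ i → ∀ a, (B i).getLast? = some a → P a) :
    ∀ a, (descFlatten B k j).getLast? = some a → P a := by
  induction k generalizing j with
  | zero => simp [descFlatten]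
  | succ k ih =>
    intro a ha
    rw [descFlatten, List.getLast?_append] at ha
    cases hB : (B j).getLast? with
    | none => exact ih (j + 1) (fun i hi => h i (by omega)) a (by simpa [hB] using ha)
    | some b => exact h j le_rfl a (by rw [hB]; simpa [hB] using ha)

theorem pair_infix_append {a b : α} {A B : List α} :
    [a, b] <:+: A ++ B ↔
      [a, b] <:+: A ∨ [a, b] <:+: B ∨ (A.getLast? = some a ∧ B.head? = some b) := by
  induction A with
  | nil => simp
  | cons c A ih =>
    rw [List.cons_append, List.infix_cons_iff, ih, List.infix_cons_iff]
    cases A with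
    | nil =>
      cases B with
      | nil => simp
      | cons d B => simp [List.cons_prefix_cons]; tauto
    | cons d A => simp [List.cons_prefix_cons]; tauto

theorem pair_infix_descFlatten {a b : α} (B : ℕ → List α) (k j : ℕ)
    (h : ∀ i, j < i → (B i).getLast? ≠ some a) :
    [a, b] <:+: descFlatten B k j ↔ ∃ i, j ≤ i ∧ i < j + k ∧ [a, b] <:+: B i := by
  induction k generalizing j with
  | zero => simp [descFlatten]; omega
  | succ k ih =>
    have hl : (descFlatten B k (j + 1)).getLast? ≠ some a := fun ha =>
      getLast?_descFlatten (P := (· ≠ a)) B k (j + 1)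
        (fun i hi c hc hca => h i hi (hca ▸ hc)) a ha rfl
    rw [descFlatten, pair_infix_append, ih (j + 1) fun i hi => h i (by omega)]
    constructor
    · rintro (⟨i, h1, h2, h3⟩ | h3 | ⟨h3, -⟩)
      · exact ⟨i, by omega, by omega, h3⟩
      · exact ⟨j, le_rfl, by omega, h3⟩
      · exact absurd h3 hl
    · rintro ⟨i, h1, h2, h3⟩
      rcases h1.eq_or_lt with rfl | h1
      · exact Or.inr (Or.inl h3)
      · exact Or.inl ⟨i, h1, by omega, h3⟩

end descFlatten

section Words

theorem count_descFlatten (B : ℕ → List Step) (hB : ∀ j, (B j).count .E = (B (j + 1)).count .N)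
    (k j : ℕ) (h : (B (j + k)).count .N = 0) :
    (descFlatten B k j).count .N = (descFlatten B k j).count .E + (B j).count .N := by
  induction k generalizing j with
  | zero => simpa [descFlatten] using h.symm
  | succ k ih =>
    have := ih (j + 1) (by rwa [Nat.add_right_comm, Nat.add_assoc])
    simp only [descFlatten, List.count_append, hB j]
    omega

theorem take_descFlatten_count_le (B : ℕ → List Step)
    (hB : ∀ j, (B j).count .E = (B (j + 1)).count .N)
    (k j : ℕ) (h : (B (j + k)).count .N = 0) (m : ℕ) :
    ((descFlatten B k j).take m).count .E ≤ ((descFlatten B k j).take m).count .N := by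
  induction k generalizing j m with
  | zero => simp [descFlatten]
  | succ k ih =>
    have h' : (B (j + 1 + k)).count .N = 0 := by rwa [Nat.add_right_comm, Nat.add_assoc]
    have h1 := ih (j + 1) h' m
    have h2 := count_descFlatten B hB k (j + 1) h'
    rw [descFlatten, List.take_append, List.count_append, List.count_append]
    rcases le_total m (descFlatten B k (j + 1)).length with hm | hm
    · simpa [Nat.sub_eq_zero_of_le hm] using h1
    · rw [List.take_of_length_le hm]
      have h3 := (List.take_sublist (m - (descFlatten B k (j + 1)).length) (B j)).count_le .E
      rw [hB j] at h3
      omega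

theorem append_cancel_of_count {A A' B B' : List Step} (hA : A.getLast? ≠ some .E)
    (hA' : A'.getLast? ≠ some .E) (h : A ++ B = A' ++ B') (hc : B.count .N = B'.count .N) :
    A = A' ∧ B = B' := by
  have key : ∀ {A A' B B' C : List Step}, A'.getLast? ≠ some .E → A' = A ++ C → B = C ++ B' →
      B.count .N = B'.count .N → C = [] := by
    intro A A' B B' C hA' h1 h2 hc
    subst h1 h2
    rcases List.eq_nil_or_concat C with rfl | ⟨C', c, rfl⟩
    · rfl
    · cases c with
      | N => simp at hc; omega
      | E => simp [← List.append_assoc] at hA'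
  rcases List.append_eq_append_iff.1 h with ⟨C, h1, h2⟩ | ⟨C, h1, h2⟩
  · have := key hA' h1 h2 hc
    subst this; simp_all
  · have := key hA h1 h2 hc.symm
    subst this; simp_all

theorem descFlatten_injective (B B' : ℕ → List Step)
    (hB : ∀ j, (B j).count .E = (B (j + 1)).count .N)
    (hB' : ∀ j, (B' j).count .E = (B' (j + 1)).count .N) (k j : ℕ)
    (hl : ∀ i, j < i → (B i).getLast? ≠ some .E) (hl' : ∀ i, j < i → (B' i).getLast? ≠ some .E)
    (h : descFlatten B k j = descFlatten B' k j) (hc : (B j).count .N = (B' j).count .N) :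
    ∀ i, j ≤ i → i < j + k → B i = B' i := by
  induction k generalizing j with
  | zero => intros; omega
  | succ k ih =>
    obtain ⟨h1, h2⟩ := append_cancel_of_count
      (fun ha => getLast?_descFlatten (P := (· ≠ .E)) B k (j + 1)
        (fun i hi c hc hca => hl i hi (hca ▸ hc)) _ ha rfl)
      (fun ha => getLast?_descFlatten (P := (· ≠ .E)) B' k (j + 1)
        (fun i hi c hc hca => hl' i hi (hca ▸ hc)) _ ha rfl) h hc
    intro i hi hi'
    rcases hi.eq_or_lt with rfl | hi
    · exact h2
    · exact ih (j + 1) (fun i hi => hl i (by omega)) (fun i hi => hl' i (by omega)) h1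
        (by rw [← hB, ← hB', h2]) i hi (by omega)

end Words

section Levels

/-- Consecutive values of a labelled sequence increase by at most one. -/
abbrev SlowChain (l : List (ℤ × ℤ)) : Prop := l.IsChain fun p q => q.1 ≤ p.1 + 1

theorem stepLabels_N_labelledBlock (j : ℤ) (l : List (ℤ × ℤ)) :
    stepLabels .N (labelledBlock j l) = level j l := by
  rw [stepLabels, labelledBlock, level, List.filterMap_filterMap]
  congr 1; funext p
  by_cases h1 : p.1 = j
  · simp [h1]
  · by_cases h2 : p.1 = j + 1 <;> simp [h1, h2]

theorem stepLabels_E_labelledBlock (j : ℤ) (l : List (ℤ × ℤ)) :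
    stepLabels .E (labelledBlock j l) = level (j + 1) l := by
  rw [stepLabels, labelledBlock, level, List.filterMap_filterMap]
  congr 1; funext p
  by_cases h1 : p.1 = j
  · simp [h1]
  · by_cases h2 : p.1 = j + 1 <;> simp [h1, h2]

theorem map_fst_labelledBlock (j : ℤ) (l : List (ℤ × ℤ)) :
    (labelledBlock j l).map Prod.fst = sPlusL j (l.map Prod.fst) := by
  rw [labelledBlock, sPlusL, List.map_filterMap, List.filterMap_map]
  congr 1; funext p
  by_cases h1 : p.1 = j
  · simp [h1]
  · by_cases h2 : p.1 = j + 1 <;> simp [h1, h2]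

theorem count_map_fst (s : Step) (L : List (Step × ℤ)) :
    (L.map Prod.fst).count s = (stepLabels s L).length := by
  induction L with
  | nil => simp [stepLabels]
  | cons p L ih =>
    unfold stepLabels at ih ⊢
    by_cases h : p.1 = s <;> simp [h, ih]

theorem getElem?_stepLabels {s : Step} {L : List (Step × ℤ)} {p : ℕ} {a : ℤ}
    (h : L[p]? = some (s, a)) :
    (stepLabels s L)[((L.map Prod.fst).take p).count s]? = some a := by
  induction L generalizing p with
  | nil => simp at h
  | cons q L ih =>
    cases p with
    | zero =>
      simp only [List.getElem?_cons_zero, Option.some.injEq] at h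
      simp [h, stepLabels]
    | succ p =>
      have := ih (p := p) (by simpa using h)
      unfold stepLabels at this ⊢
      by_cases hq : q.1 = s
      · simpa [hq] using this
      · simpa [hq, List.count_cons] using this

theorem head?_labelledBlock_ne {j : ℤ} {l : List (ℤ × ℤ)} (hl : SlowChain l)
    (h : ∀ p, l.head? = some p → p.1 ≤ j) (a : ℤ) :
    (labelledBlock j l).head? ≠ some (.E, a) := by
  induction l with
  | nil => simp [labelledBlock]
  | cons p l ih =>
    have hp := h p rfl
    unfold labelledBlock at ih ⊢
    rcases hp.eq_or_lt with hp | hp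
    · simp [hp]
    · rw [List.filterMap_cons_none (by simp [hp.ne, (hp.trans (lt_add_one j)).ne])]
      refine ih hl.tail ?_
      intro q hq
      cases l with
      | nil => simp at hq
      | cons r l =>
        obtain rfl : r = q := by simpa using hq
        have := (List.isChain_cons_cons.1 hl).1
        omega

theorem head?_labelledBlock {j : ℤ} {l : List (ℤ × ℤ)} (hl : SlowChain l)
    (h : ∀ p, l.head? = some p → p.1 ≤ j + 1) (a : ℤ) :
    (labelledBlock j l).head? = some (.E, a) ↔ l.head? = some (j + 1, a) := by
  cases l with
  | nil => simp [labelledBlock]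
  | cons p l =>
    obtain ⟨v, b⟩ := p
    by_cases hv : v = j + 1
    · subst hv; simp [labelledBlock]
    · have hv' : v ≤ j := by have := h _ rfl; simp at this; omega
      have := head?_labelledBlock_ne hl (j := j) (by simpa using hv') a
      simp [this, hv]

theorem pair_infix_labelledBlock {j : ℤ} {l : List (ℤ × ℤ)} (hl : SlowChain l) (a b : ℤ) :
    [(Step.N, b), (Step.E, a)] <:+: labelledBlock j l ↔ [(j, b), (j + 1, a)] <:+: l := by
  induction l with
  | nil => simp [labelledBlock]
  | cons p l ih =>
    obtain ⟨v, c⟩ := p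
    have hl' : SlowChain l := hl.tail
    have ih := ih hl'
    rw [List.infix_cons_iff, ← ih]
    by_cases hv : v = j
    · subst hv
      have hh := head?_labelledBlock (j := v) hl' (a := a) (by
        intro q hq
        cases l with
        | nil => simp at hq
        | cons r l =>
          obtain rfl : r = q := by simpa using hq
          exact (List.isChain_cons_cons.1 hl).1)
      have e : labelledBlock v ((v, c) :: l) = (.N, c) :: labelledBlock v l := by
        simp [labelledBlock]
      rw [e, List.infix_cons_iff, List.cons_prefix_cons, List.cons_prefix_cons]
      have hs : ∀ {α : Type} (x : α) (m : List α), [x] <+: m ↔ m.head? = some x := by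
        intro α x m
        cases m with
        | nil => simp
        | cons y m => simp [List.cons_prefix_cons, eq_comm]
      rw [hs, hs, hh]
      simp
    · have hn : ¬ [(j, b), (j + 1, a)] <+: (v, c) :: l := by
        rw [List.cons_prefix_cons]; simp [Ne.symm hv]
      by_cases hv' : v = j + 1
      · have e : labelledBlock j ((v, c) :: l) = (.E, c) :: labelledBlock j l := by
          simp [labelledBlock, hv']
        rw [e, List.infix_cons_iff, List.cons_prefix_cons]
        simp [hn]
      · have e : labelledBlock j ((v, c) :: l) = labelledBlock j l := by
          simp [labelledBlock, hv, hv']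
        rw [e]
        simp [hn]

theorem head?_sPlusL_ne {j : ℤ} {l : List ℤ} (hl : l.IsChain fun x y => y ≤ x + 1)
    (h : ∀ x, l.head? = some x → x ≤ j) : (sPlusL j l).head? ≠ some .E := by
  have e : l = (l.map fun x => (x, (0 : ℤ))).map Prod.fst := by simp [Function.comp_def]
  intro hE
  rw [e, ← map_fst_labelledBlock, List.head?_map] at hE
  obtain ⟨⟨s, a⟩, h1, rfl⟩ := Option.map_eq_some_iff.1 hE
  refine head?_labelledBlock_ne ?_ ?_ a h1
  · rw [SlowChain, List.isChain_map]; exact hl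
  · intro p hp
    rw [List.head?_map] at hp
    obtain ⟨x, hx, rfl⟩ := Option.map_eq_some_iff.1 hp
    exact h x hx

theorem eq_of_sPlusL_eq {l l' : List ℤ} (hl : l.IsChain fun x y => y ≤ x + 1)
    (hl' : l'.IsChain fun x y => y ≤ x + 1) (h : ∀ j, sPlusL j l = sPlusL j l') : l = l' := by
  have key : ∀ {x y : ℤ} {l l' : List ℤ}, (x :: l).IsChain (fun x y => y ≤ x + 1) →
      sPlusL (y - 1) (x :: l) = sPlusL (y - 1) (y :: l') → y ≤ x := by
    intro x y l l' hc he
    by_contra! hxy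
    refine head?_sPlusL_ne hc (j := y - 1) (by simp; omega) ?_
    rw [he, sPlusL, List.filterMap_cons_some (b := .E) (by simp; omega)]
    rfl
  induction l generalizing l' with
  | nil =>
    cases l' with
    | nil => rfl
    | cons y l' => simpa [sPlusL] using h y
  | cons x l ih =>
    cases l' with
    | nil => simpa [sPlusL] using h x
    | cons y l' =>
      obtain rfl : x = y := le_antisymm (key hl' (h _).symm) (key hl (h _))
      refine congrArg _ (ih hl.tail hl'.tail fun j => ?_)
      have := h j
      unfold sPlusL at this ⊢
      by_cases h1 : x = j
      · simpa [h1] using this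
      · by_cases h2 : x = j + 1
        · simpa [h2] using this
        · simpa [h1, h2] using this

end Levels

section Ebn

theorem ebn_le_succ (π : List Step) (k : ℕ) : ebn π k ≤ ebn π (k + 1) := by
  induction π generalizing k with
  | nil => cases k <;> simp [ebn]
  | cons s π ih =>
    cases s <;> rcases k with _ | k <;> simp [ebn, ih]

theorem ebn_le_count (π : List Step) (k : ℕ) : ebn π k ≤ π.count .E := by
  induction π generalizing k with
  | nil => cases k <;> simp [ebn]
  | cons s π ih =>
    cases s <;> rcases k with _ | k <;> simp [ebn, ih]

theorem ebn_one_eq_zero_iff {π : List Step} (h : 1 ≤ π.count .N) :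
    ebn π 1 = 0 ↔ π.head? = some .N := by
  cases π with
  | nil => simp at h
  | cons s π => cases s <;> simp [ebn]

theorem isRise_iff (π : List Step) (i : ℕ) :
    IsRise π i ↔ 1 ≤ i ∧ i + 1 ≤ π.count .N ∧ ebn π i = ebn π (i + 1) := by
  have h0 : ∀ (s : Step) (π : List Step) (i : ℕ), IsRise (s :: π) i ↔
      (s = .N ∧ π.head? = some .N ∧ i = 1) ∨
        ∃ i', IsRise π i' ∧ i = i' + if s = .N then 1 else 0 := by
    intro s π i
    constructor
    · rintro ⟨p, h1, h2, h3⟩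
      cases p with
      | zero =>
        left
        simp only [List.getElem?_cons_zero, Option.some.injEq] at h1
        refine ⟨h1, ?_, by simpa using h3.symm⟩
        rw [List.head?_eq_getElem?]
        simpa using h2
      | succ p =>
        right
        refine ⟨_, ⟨p, by simpa using h1, by simpa using h2, rfl⟩, ?_⟩
        rw [← h3]
        cases s <;> simp
    · rintro (⟨rfl, h2, rfl⟩ | ⟨i', ⟨p, h1, h2, h3⟩, rfl⟩)
      · exact ⟨0, by simp, by rw [List.head?_eq_getElem?] at h2; simpa using h2, by simp⟩
      · refine ⟨p + 1, by simpa using h1, by simpa using h2, ?_⟩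
        rw [← h3]
        cases s <;> simp
  induction π generalizing i with
  | nil => simp [IsRise]
  | cons s π ih =>
    rw [h0]
    simp only [ih]
    cases s with
    | E =>
      rcases i with _ | i
      · simp
      · simp [ebn]
    | N =>
      rcases i with _ | _ | i
      · simp
      · by_cases hc : 1 ≤ π.count .N
        · have h1 := ebn_one_eq_zero_iff hc
          simp [ebn, ← h1]
          grind
        · have hh : π.head? ≠ some .N := by
            intro hh
            exact hc (List.count_pos_iff.2 (List.mem_of_head? hh))
          have : π.count .N = 0 := by omega
          simp [hh, this]
      · simp only [ebn, List.count_cons_self]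
        constructor
        · rintro (⟨-, -, h⟩ | ⟨i', h1, h2⟩)
          · omega
          · obtain rfl : i' = i + 1 := by simp at h2; omega
            exact ⟨by omega, by omega, h1.2.2⟩
        · rintro ⟨h1, h2, h3⟩
          exact Or.inr ⟨i + 1, ⟨by omega, by omega, h3⟩, by simp⟩

theorem eq_of_ebn_eq {π π' : List Step} (hN : π.count .N = π'.count .N)
    (hE : π.count .E = π'.count .E)
    (h : ∀ k, 1 ≤ k → k ≤ π.count .N → ebn π k = ebn π' k) : π = π' := by
  induction π generalizing π' with
  | nil =>
    cases π' with
    | nil => rfl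
    | cons s π' => cases s <;> simp at hN hE
  | cons s π ih =>
    cases π' with
    | nil => cases s <;> simp at hN hE
    | cons s' π' =>
      cases s <;> cases s'
      · simp only [List.count_cons_self, Nat.add_right_cancel_iff] at hN
        rw [ih hN (by simpa using hE)]
        intro k hk hk'
        simpa [ebn] using h (k + 1) (by omega) (by simpa using hk')
      · have := h 1 le_rfl (by simp)
        simp [ebn] at this
      · have := h 1 le_rfl (by rw [hN]; simp)
        simp [ebn] at this
      · simp only [List.count_cons_self, Nat.add_right_cancel_iff] at hE
        rw [ih (by simpa using hN) hE]
        intro k hk hk'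
        obtain ⟨k, rfl⟩ := Nat.exists_eq_add_of_le' hk
        simpa [ebn] using h (k + 1) (by omega) (by simpa using hk')

end Ebn

section Doubling

/-- Negation of value and label. -/
abbrev negPair (p : ℤ × ℤ) : ℤ × ℤ := (-p.1, -p.2)

/-- The reversed area vector of `π`, labelled by `u`. -/
def labelledArea (n : ℕ) (π : List Step) (u : Fin n → ℤ) : List (ℤ × ℤ) :=
  (List.finRange n).map fun j => (areaC n π (n - j.val), u j)

/-- The antisymmetric mirror image of a labelled sequence. -/
def mirror (l : List (ℤ × ℤ)) : List (ℤ × ℤ) := (l.map negPair).reverse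

theorem map_negPair_map_negPair (l : List (ℤ × ℤ)) : (l.map negPair).map negPair = l := by
  simp [negPair, Function.comp_def]

theorem pair_infix_iff {α : Type*} {x y : α} {l : List α} :
    [x, y] <:+: l ↔ ∃ i : ℕ, l[i]? = some x ∧ l[i + 1]? = some y := by
  induction l with
  | nil => simp
  | cons z l ih =>
    rw [List.infix_cons_iff, ih, List.cons_prefix_cons]
    constructor
    · rintro (⟨rfl, h⟩ | ⟨i, h1, h2⟩)
      · exact ⟨0, by simp, by cases l <;> simp_all⟩
      · exact ⟨i + 1, by simpa using h1, by simpa using h2⟩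
    · rintro ⟨i, h1, h2⟩
      cases i with
      | zero => left; cases l <;> simp_all
      | succ i => exact Or.inr ⟨i, by simpa using h1, by simpa using h2⟩

theorem pair_infix_mirror {x y : ℤ × ℤ} {l : List (ℤ × ℤ)} :
    [x, y] <:+: mirror l ↔ [negPair y, negPair x] <:+: l := by
  rw [mirror, ← isInfix_reverse_iff]
  simp only [List.reverse_reverse, List.reverse_cons, List.reverse_nil, List.nil_append,
    List.cons_append]
  constructor
  · intro h
    have := h.map negPair
    rwa [map_negPair_map_negPair] at this
  · intro h
    simpa [negPair] using h.map negPair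

theorem slowChain_append_mirror {l : List (ℤ × ℤ)} (hl : SlowChain l)
    (h : ∀ p, l.getLast? = some p → 0 ≤ p.1) : SlowChain (l ++ mirror l) := by
  rw [SlowChain, List.isChain_append]
  refine ⟨hl, ?_, ?_⟩
  · rw [mirror, List.isChain_reverse, List.isChain_map]
    refine hl.imp fun a b h => ?_
    change -a.1 ≤ -b.1 + 1
    omega
  · intro p hp q hq
    simp only [mirror, List.head?_reverse, List.getLast?_map, Option.mem_def] at hp hq
    rw [hp] at hq
    have := h p hp
    simp at hq
    rw [← hq]
    simp only
    omega

theorem pair_infix_append_mirror {j a b : ℤ} {l : List (ℤ × ℤ)} :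
    [(j, b), (j + 1, a)] <:+: l ++ mirror l ↔
      [(j, b), (j + 1, a)] <:+: l ∨ [(-j - 1, -a), (-j - 1 + 1, -b)] <:+: l := by
  rw [pair_infix_append, pair_infix_mirror]
  have h : ¬ (l.getLast? = some (j, b) ∧ (mirror l).head? = some (j + 1, a)) := by
    rintro ⟨h1, h2⟩
    simp only [mirror, List.head?_reverse, List.getLast?_map, h1, Option.map_some,
      Option.some.injEq, Prod.mk.injEq] at h2
    omega
  simp only [h, or_false, negPair, neg_add', sub_add_cancel]

theorem level_mirror (v : ℤ) (l : List (ℤ × ℤ)) :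
    level v (mirror l) = ((level (-v) l).map fun x => -x).reverse := by
  rw [level, level, mirror, List.filterMap_reverse, List.filterMap_map, List.map_filterMap]
  congr 2; funext p
  by_cases h : p.1 = -v
  · simp [h]
  · have : ¬ -p.1 = v := by omega
    simp [h, this]

theorem level_eq_nil {v : ℤ} {l : List (ℤ × ℤ)} (h : ∀ p ∈ l, p.1 ≠ v) : level v l = [] := by
  rw [level, List.filterMap_eq_nil_iff]
  intro p hp
  simp [h p hp]

end Doubling

section Area

variable {n : ℕ} {π : List Step}

theorem areaC_sub {j : ℕ} (hj : j < n) : areaC n π (n - j) = (j : ℤ) + 1 - ebn π (j + 1) := by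
  have : n + 1 - (n - j) = j + 1 := by omega
  rw [areaC, this]
  push_cast [Nat.cast_sub hj.le]
  ring

theorem getElem?_labelledArea (u : Fin n → ℤ) (i : ℕ) (p : ℤ × ℤ) :
    (labelledArea n π u)[i]? = some p ↔
      ∃ h : i < n, p = ((i : ℤ) + 1 - ebn π (i + 1), u ⟨i, h⟩) := by
  simp only [labelledArea, List.getElem?_map, Option.map_eq_some_iff]
  constructor
  · rintro ⟨j, h1, rfl⟩
    obtain ⟨h, rfl⟩ := List.getElem?_eq_some_iff.1 h1
    simp only [List.length_finRange] at h
    exact ⟨h, by simp [areaC_sub h]⟩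
  · rintro ⟨h, rfl⟩
    exact ⟨⟨i, h⟩, by simp [h], by simp [areaC_sub h]⟩

theorem length_labelledArea (u : Fin n → ℤ) : (labelledArea n π u).length = n := by
  simp [labelledArea]

theorem slowChain_labelledArea (u : Fin n → ℤ) : SlowChain (labelledArea n π u) := by
  rw [SlowChain, List.isChain_iff_getElem]
  intro i hi
  obtain ⟨h1, e1⟩ := (getElem?_labelledArea u i _).1
    (List.getElem?_eq_getElem (Nat.lt_of_succ_lt hi))
  obtain ⟨h2, e2⟩ := (getElem?_labelledArea u (i + 1) _).1 (List.getElem?_eq_getElem hi)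
  rw [e1, e2]
  have := ebn_le_succ π (i + 1)
  push_cast
  omega

theorem mem_labelledArea_bound (hπ : IsLatticePath n n π) (u : Fin n → ℤ) {p : ℤ × ℤ}
    (hp : p ∈ labelledArea n π u) : -n < p.1 ∧ p.1 ≤ n := by
  obtain ⟨i, hi⟩ := List.mem_iff_getElem?.1 hp
  obtain ⟨h, rfl⟩ := (getElem?_labelledArea u i _).1 hi
  have := ebn_le_count π (i + 1)
  rw [hπ.1] at this
  constructor <;> simp only <;> omega

theorem head?_labelledArea_le (u : Fin n → ℤ) {p : ℤ × ℤ}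
    (hp : (labelledArea n π u).head? = some p) : p.1 ≤ 1 := by
  rw [List.head?_eq_getElem?] at hp
  obtain ⟨h, rfl⟩ := (getElem?_labelledArea u 0 _).1 hp
  simp

theorem getLast?_labelledArea_nonneg (hπ : IsLatticePath n n π) (u : Fin n → ℤ) {p : ℤ × ℤ}
    (hp : (labelledArea n π u).getLast? = some p) : 0 ≤ p.1 := by
  rw [List.getLast?_eq_getElem?, length_labelledArea] at hp
  obtain ⟨h, rfl⟩ := (getElem?_labelledArea u (n - 1) _).1 hp
  have := ebn_le_count π (n - 1 + 1)
  rw [hπ.1] at this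
  simp only
  omega

/-- The labelled area vector of `π` followed by its mirror image. -/
def doubledArea (n : ℕ) (π : List Step) (u : Fin n → ℤ) : List (ℤ × ℤ) :=
  labelledArea n π u ++ mirror (labelledArea n π u)

theorem slowChain_doubledArea (hπ : IsLatticePath n n π) (u : Fin n → ℤ) :
    SlowChain (doubledArea n π u) :=
  slowChain_append_mirror (slowChain_labelledArea u) fun _ => getLast?_labelledArea_nonneg hπ u

theorem mem_doubledArea_bound (hπ : IsLatticePath n n π) (u : Fin n → ℤ) {p : ℤ × ℤ}
    (hp : p ∈ doubledArea n π u) : p.1 ≤ n := by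
  rw [doubledArea, mirror, List.mem_append, List.mem_reverse, List.mem_map] at hp
  rcases hp with hp | ⟨q, hq, rfl⟩
  · exact (mem_labelledArea_bound hπ u hp).2
  · have := (mem_labelledArea_bound hπ u hq).1
    simp only
    omega

theorem head?_doubledArea (u : Fin n → ℤ) :
    (doubledArea n π u).head? = (labelledArea n π u).head? := by
  rw [doubledArea, List.head?_append]
  cases h : labelledArea n π u <;> simp [mirror]

/-- The labelled word underlying the zeta map. -/
def labelledZeta (n : ℕ) (π : List Step) (u : Fin n → ℤ) : List (Step × ℤ) :=
  descFlatten (fun j => (labelledBlock (j : ℤ) (doubledArea n π u)).reverse) (n + 1) 0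

theorem reverse_areaCList (u : Fin n → ℤ) :
    (areaCList n π).reverse = (labelledArea n π u).map Prod.fst := by
  apply List.ext_getElem
  · simp [areaCList, labelledArea]
  · intro i h1 h2
    simp only [areaCList, List.length_reverse, List.length_map, List.length_range] at h1
    have : n - 1 - i + 1 = n - i := by omega
    simp [areaCList, labelledArea, this]

theorem sMinusL_eq (j : ℤ) (l : List ℤ) : sMinusL j l = sPlusL j (l.map fun x => -x) := by
  rw [sMinusL, sPlusL, List.filterMap_map]
  congr 1; funext x
  have h1 : x = -j ↔ -x = j := by omega
  have h2 : x = -j - 1 ↔ -x = j + 1 := by omega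
  simp [h1, h2]

theorem map_fst_doubledArea (u : Fin n → ℤ) : (doubledArea n π u).map Prod.fst =
    (areaCList n π).reverse ++ (areaCList n π).map fun x => -x := by
  rw [doubledArea, List.map_append, ← reverse_areaCList, mirror, List.map_reverse, List.map_map,
    ← List.reverse_reverse (areaCList n π), reverse_areaCList u]
  simp [Function.comp_def]

theorem map_fst_labelledZeta (u : Fin n → ℤ) : (labelledZeta n π u).map Prod.fst =
    descFlatten (fun j => sPlusL (j : ℤ) ((doubledArea n π u).map Prod.fst).reverse) (n + 1) 0 := by
  rw [labelledZeta, map_descFlatten]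
  congr 1; funext j
  rw [List.map_reverse, map_fst_labelledBlock, sPlusL, sPlusL, List.filterMap_reverse]

theorem bind_pure_cast (l : List ℕ) :
    (do let a ← l; pure (a : ℤ)) = l.map fun a : ℕ => (a : ℤ) := by
  simp [List.map_eq_flatMap]

theorem zetaC_eq (u : Fin n → ℤ) : zetaC n π = (labelledZeta n π u).map Prod.fst := by
  rw [map_fst_labelledZeta, zetaC, bind_pure_cast, List.map_map, ← flatten_reverse_range_map]
  congr 2; funext j
  rw [Function.comp_apply, map_fst_doubledArea, List.reverse_append, List.reverse_reverse,
    sMinusR, sMinusL_eq]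
  simp [sPlusL]

theorem reverse_dCList (u : Fin n → ℤ) : (dCList n π u).reverse =
    descFlatten (fun i => (level ((i + 1 : ℕ) : ℤ) (labelledArea n π u)).reverse ++
      (level (i : ℤ) (mirror (labelledArea n π u))).reverse) (n + 1) 0 := by
  rw [dCList, bind_pure_cast, List.reverse_flatten, List.map_map, List.map_map,
    ← List.map_reverse, ← flatten_reverse_range_map]
  congr 2; funext i
  simp only [Function.comp_apply, List.reverse_append, Nat.add_zero]
  congr 2
  · rw [level, labelledArea, List.filterMap_map]
    simp
  · rw [level, mirror, labelledArea, List.map_map, ← List.map_reverse, List.filterMap_map]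
    congr 1; funext j
    simp only [Function.comp_apply, negPair, neg_eq_iff_eq_neg]

end Area

section ReadingWord

variable {n : ℕ} {π : List Step}

/-- The positions, together with the signs, of the letters of the diagonal reading word. -/
def readingIndex (n : ℕ) (π : List Step) : List (Fin n × ℤ) :=
  ((List.range (n + 1)).map fun i : ℕ =>
    (((List.finRange n).reverse.filter fun j => areaC n π (n - j.val) = -(i : ℤ)).map
      fun j => (j, (-1 : ℤ))) ++
    (((List.finRange n).filter fun j => areaC n π (n - j.val) = (i : ℤ) + 1).map
      fun j => (j, (1 : ℤ)))).flatten

theorem dCList_eq_map_readingIndex (u : Fin n → ℤ) :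
    dCList n π u = (readingIndex n π).map fun p => p.2 * u p.1 := by
  rw [dCList, bind_pure_cast, readingIndex, List.map_map, List.map_flatten, List.map_map]
  congr 2; funext i
  simp only [Function.comp_apply, List.map_append, List.map_map]
  congr 1
  · rw [← List.filterMap_eq_map, List.filterMap_filter]
    congr 1; funext j
    simp
  · rw [← List.filterMap_eq_map, List.filterMap_filter]
    congr 1; funext j
    simp

theorem sign_of_mem_readingIndex {q : Fin n × ℤ} (hq : q ∈ readingIndex n π) :
    q.2 = 1 ∨ q.2 = -1 := by
  simp only [readingIndex, List.mem_flatten, List.mem_map] at hq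
  obtain ⟨l, ⟨i, -, rfl⟩, hq⟩ := hq
  simp only [List.mem_append, List.mem_map] at hq
  rcases hq with ⟨j, -, rfl⟩ | ⟨j, -, rfl⟩
  · exact Or.inr rfl
  · exact Or.inl rfl

theorem map_fst_readingIndex_perm (hπ : IsLatticePath n n π) :
    ((readingIndex n π).map Prod.fst).Perm (List.finRange n) := by
  have e : (readingIndex n π).map Prod.fst = ((List.range (n + 1)).map fun i : ℕ =>
      ((List.finRange n).reverse.filter fun j => areaC n π (n - j.val) = -(i : ℤ)) ++
      ((List.finRange n).filter fun j => areaC n π (n - j.val) = (i : ℤ) + 1)).flatten := by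
    rw [readingIndex, List.map_flatten, List.map_map]
    congr 2; funext i
    simp [Function.comp_def]
  rw [e]
  refine (List.perm_ext_iff_of_nodup ?_ (List.nodup_finRange n)).2 fun j => ?_
  · rw [List.nodup_flatten, List.pairwise_map]
    constructor
    · intro l hl
      obtain ⟨i, -, rfl⟩ := List.mem_map.1 hl
      refine List.Nodup.append ((List.nodup_reverse.2 (List.nodup_finRange n)).filter _)
        ((List.nodup_finRange n).filter _) ?_
      intro j h1 h2
      simp only [List.mem_filter, decide_eq_true_eq] at h1 h2
      omega
    · refine List.pairwise_lt_range.imp ?_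
      intro i i' hi j h1 h2
      simp only [List.mem_append, List.mem_filter, decide_eq_true_eq] at h1 h2
      omega
  · have h1 := ebn_le_count π (j.val + 1)
    rw [hπ.1] at h1
    have h2 := areaC_sub (π := π) j.2
    simp only [List.mem_finRange, iff_true, List.mem_flatten, List.mem_map, List.mem_range]
    by_cases h : 0 < areaC n π (n - j.val)
    · refine ⟨_, ⟨(areaC n π (n - j.val) - 1).toNat, by omega, rfl⟩, ?_⟩
      refine List.mem_append_right _ (List.mem_filter.2 ⟨List.mem_finRange j, ?_⟩)
      rw [decide_eq_true_eq]
      omega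
    · refine ⟨_, ⟨(-areaC n π (n - j.val)).toNat, by omega, rfl⟩, ?_⟩
      refine List.mem_append_left _ (List.mem_filter.2
        ⟨List.mem_reverse.2 (List.mem_finRange j), ?_⟩)
      rw [decide_eq_true_eq]
      omega

theorem length_readingIndex (hπ : IsLatticePath n n π) : (readingIndex n π).length = n := by
  simpa using (map_fst_readingIndex_perm hπ).length_eq

theorem length_dCList (hπ : IsLatticePath n n π) (u : Fin n → ℤ) :
    (dCList n π u).length = n := by
  rw [dCList_eq_map_readingIndex, List.length_map, length_readingIndex hπ]

theorem dC_eq_signed_comp (hπ : IsLatticePath n n π) :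
    ∃ (σ : Equiv.Perm (Fin n)) (ε : Fin n → ℤ), (∀ k, ε k = 1 ∨ ε k = -1) ∧
      ∀ u k, dC n π u k = ε k * u (σ k) := by
  have hlen := length_readingIndex hπ
  have hnd : ((readingIndex n π).map Prod.fst).Nodup :=
    (map_fst_readingIndex_perm hπ).nodup_iff.2 (List.nodup_finRange n)
  let σ : Fin n → Fin n := fun k => ((readingIndex n π)[k.val]'(by omega)).1
  have hσ : Function.Injective σ := by
    intro k k' h
    have h1 := (List.Nodup.getElem_inj_iff hnd (i := k.val) (j := k'.val)
      (hi := by rw [List.length_map]; omega) (hj := by rw [List.length_map]; omega)).1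
      (by simpa [σ] using h)
    exact Fin.ext h1
  refine ⟨Equiv.ofBijective σ (Finite.injective_iff_bijective.1 hσ),
    fun k => ((readingIndex n π)[k.val]'(by omega)).2, fun k => ?_, fun u k => ?_⟩
  · exact sign_of_mem_readingIndex (List.getElem_mem _)
  · rw [dC, List.getD_eq_getElem _ _ (by rw [length_dCList hπ]; exact k.2)]
    simp [dCList_eq_map_readingIndex, σ]

theorem isSignedPerm_signed_comp_iff {σ : Equiv.Perm (Fin n)} {ε : Fin n → ℤ}
    (hε : ∀ k, ε k = 1 ∨ ε k = -1) {u w : Fin n → ℤ} (h : ∀ k, w k = ε k * u (σ k)) :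
    IsSignedPerm n w ↔ IsSignedPerm n u := by
  have habs : (fun i => |w i|) = (fun i => |u i|) ∘ σ := by
    funext k
    rcases hε k with e | e <;> simp [h, e]
  have habs' : ∀ k, |w k| = |u (σ k)| := fun k => congrFun habs k
  rw [IsSignedPerm, IsSignedPerm, habs, σ.injective_comp]
  simp only [habs']
  rw [σ.forall_congr_left]
  simp

theorem isSignedPerm_dC_iff (hπ : IsLatticePath n n π) (u : Fin n → ℤ) :
    IsSignedPerm n (dC n π u) ↔ IsSignedPerm n u := by
  obtain ⟨σ, ε, hε, h⟩ := dC_eq_signed_comp hπ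
  exact isSignedPerm_signed_comp_iff hε (h u)

theorem dC_bijective (hπ : IsLatticePath n n π) : Function.Bijective (dC n π) := by
  obtain ⟨σ, ε, hε, h⟩ := dC_eq_signed_comp hπ
  have hε' : ∀ k, ε k * ε k = 1 := fun k => by rcases hε k with e | e <;> simp [e]
  constructor
  · intro u u' huu
    funext j
    have h1 := congrFun huu (σ.symm j)
    rw [h, h, Equiv.apply_symm_apply] at h1
    rcases hε (σ.symm j) with e | e <;> simpa [e] using h1
  · intro w
    refine ⟨fun j => ε (σ.symm j) * w (σ.symm j), ?_⟩
    funext k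
    rw [h, Equiv.symm_apply_apply, ← mul_assoc, hε', one_mul]

end ReadingWord

section EvalSP

variable {n : ℕ}

theorem evalSP_neg (w : Fin n → ℤ) (j : ℤ) : evalSP w (-j) = -evalSP w j := by
  unfold evalSP
  simp only [neg_neg]
  by_cases h1 : 1 ≤ j ∧ j ≤ (n : ℤ)
  · have h2 : ¬ (1 ≤ -j ∧ -j ≤ (n : ℤ)) := by omega
    rw [dif_neg h2, dif_pos h1, dif_pos h1]
  · by_cases h2 : 1 ≤ -j ∧ -j ≤ (n : ℤ)
    · rw [dif_pos h2, dif_neg h1, dif_pos h2, neg_neg]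
    · rw [dif_neg h2, dif_neg h1, dif_neg h1, dif_neg h2, neg_zero]

theorem evalSP_succ (w : Fin n → ℤ) {i : ℕ} (hi : i < n) : evalSP w ((i : ℤ) + 1) = w ⟨i, hi⟩ := by
  rw [evalSP, dif_pos (by omega)]
  congr 1
  simp

end EvalSP

section Conditions

variable {n : ℕ} {π : List Step}

theorem vertical_condition_iff (hn : 1 ≤ n) (hπ : IsLatticePath n n π) (u : Fin n → ℤ) :
    ((∀ i : ℕ, IsRise π i → evalSP u (i : ℤ) < evalSP u ((i : ℤ) + 1)) ∧
      (π.head? = some Step.N → 0 < evalSP u 1)) ↔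
    ((∀ v a b, [(v, b), (v + 1, a)] <:+: labelledArea n π u → b < a) ∧
      ∀ a, (labelledArea n π u).head? = some (1, a) → 0 < a) := by
  have e1 : evalSP u 1 = u ⟨0, hn⟩ := by simpa using evalSP_succ u (i := 0) hn
  refine and_congr ⟨fun h v a b hab => ?_, fun h i hi => ?_⟩ ⟨fun h a ha => ?_, fun h hh => ?_⟩
  · obtain ⟨i, h1, h2⟩ := pair_infix_iff.1 hab
    obtain ⟨hi1, e1⟩ := (getElem?_labelledArea u i _).1 h1
    obtain ⟨hi2, e2⟩ := (getElem?_labelledArea u (i + 1) _).1 h2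
    simp only [Prod.mk.injEq] at e1 e2
    have := h (i + 1) ((isRise_iff π _).2 ⟨by omega, by rw [hπ.2]; omega, by omega⟩)
    rw [e1.2, e2.2, ← evalSP_succ u hi1, ← evalSP_succ u hi2]
    exact_mod_cast this
  · obtain ⟨h1, h2, h3⟩ := (isRise_iff π _).1 hi
    rw [hπ.2] at h2
    obtain ⟨i, rfl⟩ := Nat.exists_eq_add_of_le' h1
    have := h ((i : ℤ) + 1 - ebn π (i + 1)) (u ⟨i + 1, h2⟩) (u ⟨i, by omega⟩)
      (pair_infix_iff.2 ⟨i, (getElem?_labelledArea u i _).2 ⟨by omega, rfl⟩,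
        (getElem?_labelledArea u (i + 1) _).2 ⟨h2, by
          rw [← h3]; simp only [Prod.mk.injEq, and_true]; push_cast; ring⟩⟩)
    rw [← evalSP_succ u (i := i) (by omega), ← evalSP_succ u h2] at this
    exact_mod_cast this
  · rw [List.head?_eq_getElem?] at ha
    obtain ⟨h1, h2⟩ := (getElem?_labelledArea u 0 _).1 ha
    simp only [Prod.mk.injEq] at h2
    rw [h2.2, ← e1]
    refine h ((ebn_one_eq_zero_iff (by rw [hπ.2]; exact hn)).1 ?_)
    simp only [zero_add] at h2
    omega
  · rw [e1]
    refine h _ ?_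
    rw [List.head?_eq_getElem?, getElem?_labelledArea]
    have := (ebn_one_eq_zero_iff (by rw [hπ.2]; exact hn)).2 hh
    exact ⟨hn, by simp [this]⟩

theorem labelledZeta_condition_iff (hπ : IsLatticePath n n π) (u : Fin n → ℤ) :
    ((∀ a b, [(Step.E, a), (Step.N, b)] <:+: labelledZeta n π u → b < a) ∧
      ∀ a, (labelledZeta n π u).getLast? = some (Step.E, a) → 0 < a) ↔
    ((∀ v a b, [(v, b), (v + 1, a)] <:+: labelledArea n π u → b < a) ∧
      ∀ a, (labelledArea n π u).head? = some (1, a) → 0 < a) := by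
  have hc := slowChain_doubledArea hπ u
  have hh : ∀ p, (doubledArea n π u).head? = some p → p.1 ≤ 1 := by
    intro p hp
    rw [head?_doubledArea] at hp
    exact head?_labelledArea_le u hp
  have hlast : ∀ (i : ℕ) (a : ℤ), 0 < i →
      (labelledBlock (i : ℤ) (doubledArea n π u)).reverse.getLast? ≠ some (.E, a) := by
    intro i a hi
    rw [List.getLast?_reverse]
    exact head?_labelledBlock_ne hc (fun p hp => (hh p hp).trans (by omega)) a
  have hinf : ∀ a b, [(Step.E, a), (Step.N, b)] <:+: labelledZeta n π u ↔
      ∃ j : ℕ, [((j : ℤ), b), ((j : ℤ) + 1, a)] <:+: doubledArea n π u := by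
    intro a b
    rw [labelledZeta, pair_infix_descFlatten _ _ _ fun i hi => hlast i a hi]
    constructor
    · rintro ⟨j, -, -, h⟩
      rw [← isInfix_reverse_iff] at h
      exact ⟨j, (pair_infix_labelledBlock hc a b).1 (by simpa using h)⟩
    · rintro ⟨j, h⟩
      have := mem_doubledArea_bound hπ u (h.subset (List.mem_cons_self ..))
      refine ⟨j, by omega, by simp only at this; omega, ?_⟩
      rw [← isInfix_reverse_iff]
      simpa using (pair_infix_labelledBlock hc a b).2 h
  have hend : ∀ a, (labelledZeta n π u).getLast? = some (.E, a) ↔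
      (labelledArea n π u).head? = some (1, a) := by
    intro a
    rw [← head?_doubledArea]
    have hb := head?_labelledBlock (j := 0) hc (a := a) (by simpa using hh)
    rw [zero_add] at hb
    rw [← hb, labelledZeta, descFlatten, List.getLast?_append, List.getLast?_reverse]
    cases hB : (labelledBlock ((0 : ℕ) : ℤ) (doubledArea n π u)).head? with
    | some x => simp
    | none =>
      simp only [Option.none_or, reduceCtorEq, iff_false]
      intro ha
      exact getLast?_descFlatten (P := (· ≠ (Step.E, a))) _ n (0 + 1)
        (fun i hi c hc hca => hlast i a (by omega) (hca ▸ hc)) _ ha rfl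
  simp only [hinf, hend]
  refine and_congr_left fun _ => ⟨fun h v a b hab => ?_, fun h a b => ?_⟩
  · by_cases hv : 0 ≤ v
    · refine h a b ⟨v.toNat, ?_⟩
      rw [Int.toNat_of_nonneg hv]
      exact pair_infix_append_mirror.2 (Or.inl hab)
    · have := h (-b) (-a) ⟨(-v - 1).toNat, ?_⟩
      · omega
      rw [Int.toNat_of_nonneg (by omega)]
      refine pair_infix_append_mirror.2 (Or.inr ?_)
      simpa using hab
  · rintro ⟨j, hj⟩
    rcases pair_infix_append_mirror.1 hj with hj | hj
    · exact h _ _ _ hj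
    · have := h _ _ _ hj
      omega

end Conditions

section Valleys

variable {n : ℕ} {π : List Step}

theorem stepLabels_labelledZeta (s : Step) (u : Fin n → ℤ) :
    stepLabels s (labelledZeta n π u) = descFlatten
      (fun j => (stepLabels s (labelledBlock (j : ℤ) (doubledArea n π u))).reverse) (n + 1) 0 := by
  rw [labelledZeta, stepLabels, filterMap_descFlatten]
  congr 1; funext j
  rw [List.filterMap_reverse, stepLabels]

/-- The negated labels of the entries of value zero. -/
def negZeroLabels (n : ℕ) (π : List Step) (u : Fin n → ℤ) : List ℤ :=
  (level 0 (labelledArea n π u)).map fun x => -x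

theorem reverse_level_zero_mirror (u : Fin n → ℤ) :
    (level 0 (mirror (labelledArea n π u))).reverse = negZeroLabels n π u := by
  rw [level_mirror, neg_zero, List.reverse_reverse, negZeroLabels]

theorem stepLabels_N_labelledZeta (hπ : IsLatticePath n n π) (u : Fin n → ℤ) :
    stepLabels .N (labelledZeta n π u) =
      (dCList n π u).reverse ++ ((negZeroLabels n π u).map fun x => -x).reverse := by
  have h := descFlatten_shift (fun i : ℕ => (level (i : ℤ) (labelledArea n π u)).reverse)
    (fun i : ℕ => (level (i : ℤ) (mirror (labelledArea n π u))).reverse) (n + 1) 0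
  have h0 : level ((0 + (n + 1) : ℕ) : ℤ) (labelledArea n π u) = [] :=
    level_eq_nil fun p hp h => by have := mem_labelledArea_bound hπ u hp; omega
  have h1 : (negZeroLabels n π u).map (fun x => -x) = level 0 (labelledArea n π u) := by
    simp [negZeroLabels]
  rw [h1, stepLabels_labelledZeta, reverse_dCList, ← Nat.cast_zero (R := ℤ), h]
  simp only [h0, List.reverse_nil, List.nil_append, stepLabels_N_labelledBlock]
  congr 1; funext j
  simp [doubledArea, level]

theorem reverse_dCList_eq_append (hπ : IsLatticePath n n π) (u : Fin n → ℤ) :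
    (dCList n π u).reverse = stepLabels .E (labelledZeta n π u) ++ negZeroLabels n π u := by
  have h := descFlatten_shift
    (fun i : ℕ => (level (i : ℤ) (mirror (labelledArea n π u))).reverse)
    (fun i : ℕ => (level ((i + 1 : ℕ) : ℤ) (labelledArea n π u)).reverse) (n + 1) 0
  have h0 : level ((0 + (n + 1) : ℕ) : ℤ) (mirror (labelledArea n π u)) = [] := by
    refine level_eq_nil fun p hp h => ?_
    have := mem_doubledArea_bound hπ u (List.mem_append_right _ hp)
    omega
  rw [← reverse_level_zero_mirror, reverse_dCList, stepLabels_labelledZeta]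
  simp only [h0, List.reverse_nil, List.nil_append] at h
  rw [← h, Nat.cast_zero]
  congr 2; funext j
  rw [stepLabels_E_labelledBlock]
  simp [doubledArea, level]

theorem length_stepLabels_E (hπ : IsLatticePath n n π) (u : Fin n → ℤ) :
    (stepLabels .E (labelledZeta n π u)).length + (negZeroLabels n π u).length = n := by
  rw [← List.length_append, ← reverse_dCList_eq_append hπ, List.length_reverse, length_dCList hπ]

theorem length_stepLabels_N (hπ : IsLatticePath n n π) (u : Fin n → ℤ) :
    (stepLabels .N (labelledZeta n π u)).length = n + (negZeroLabels n π u).length := by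
  rw [stepLabels_N_labelledZeta hπ]
  simp [length_dCList hπ]

theorem getElem?_reverse_dCList (hπ : IsLatticePath n n π) (u : Fin n → ℤ) {k : ℕ} (hk : k < n) :
    (dCList n π u).reverse[k]? = some (evalSP (dC n π u) ((n : ℤ) - k)) := by
  have hlen := length_dCList hπ u
  have e : (n : ℤ) - k = ((n - 1 - k : ℕ) : ℤ) + 1 := by omega
  rw [e, evalSP_succ _ (by omega : n - 1 - k < n), List.getElem?_reverse (by omega), hlen, dC,
    List.getD_eq_getElem _ _ (by rw [hlen]; simp only; omega), List.getElem?_eq_getElem]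

theorem evalSP_dC_of_label_E (hπ : IsLatticePath n n π) (u : Fin n → ℤ) {k : ℕ} {a : ℤ}
    (h : (stepLabels .E (labelledZeta n π u))[k]? = some a) :
    k < n ∧ evalSP (dC n π u) ((n : ℤ) - k) = a := by
  have hk := (List.getElem?_eq_some_iff.1 h).1
  have hlen := length_stepLabels_E hπ u
  have := getElem?_reverse_dCList hπ u (k := k) (by omega)
  rw [reverse_dCList_eq_append hπ, List.getElem?_append_left hk, h, Option.some_inj] at this
  exact ⟨by omega, this.symm⟩

theorem evalSP_dC_of_label_N (hπ : IsLatticePath n n π) (u : Fin n → ℤ) {k : ℕ} {b : ℤ}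
    (h : (stepLabels .N (labelledZeta n π u))[k]? = some b) :
    (k < n → evalSP (dC n π u) ((n : ℤ) - k) = b) ∧
      (n ≤ k → evalSP (dC n π u) ((n : ℤ) - 1 - k) = b) := by
  have hk := (List.getElem?_eq_some_iff.1 h).1
  rw [length_stepLabels_N hπ] at hk
  rw [stepLabels_N_labelledZeta hπ] at h
  have hlen : (dCList n π u).reverse.length = n := by
    rw [List.length_reverse, length_dCList hπ]
  constructor
  · intro hkn
    rw [List.getElem?_append_left (by omega), getElem?_reverse_dCList hπ u hkn] at h
    exact Option.some_inj.1 h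
  · intro hkn
    have hE := length_stepLabels_E hπ u
    rw [List.getElem?_append_right (by omega), hlen,
      List.getElem?_reverse (by rw [List.length_map]; omega), List.getElem?_map,
      List.length_map] at h
    obtain ⟨c, hc, rfl⟩ := Option.map_eq_some_iff.1 h
    have h1 := getElem?_reverse_dCList hπ u (k := 2 * n - 1 - k) (by omega)
    rw [reverse_dCList_eq_append hπ, List.getElem?_append_right (by omega)] at h1
    have e : 2 * n - 1 - k - (stepLabels .E (labelledZeta n π u)).length =
        (negZeroLabels n π u).length - 1 - (k - n) := by omega
    rw [e, hc, Option.some_inj] at h1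
    rw [h1, ← evalSP_neg]
    congr 1
    omega

theorem valley_condition_iff (hπ : IsLatticePath n n π) (u : Fin n → ℤ) :
    (∀ i j : ℕ, IsValley (zetaC n π) i j →
      (j ≤ n → evalSP (dC n π u) ((n : ℤ) + 1 - j) < evalSP (dC n π u) ((n : ℤ) + 1 - i)) ∧
      (n < j → evalSP (dC n π u) ((n : ℤ) - j) < evalSP (dC n π u) ((n : ℤ) + 1 - i))) ↔
    ((∀ a b, [(Step.E, a), (Step.N, b)] <:+: labelledZeta n π u → b < a) ∧
      ∀ a, (labelledZeta n π u).getLast? = some (Step.E, a) → 0 < a) := by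
  rw [zetaC_eq u]
  have hget : ∀ {p : ℕ} {s : Step}, ((labelledZeta n π u).map Prod.fst)[p]? = some s →
      ∃ a, (labelledZeta n π u)[p]? = some (s, a) := by
    intro p s h
    rw [List.getElem?_map] at h
    obtain ⟨⟨t, a⟩, h', rfl⟩ := Option.map_eq_some_iff.1 h
    exact ⟨a, h'⟩
  have hinner : ∀ {p : ℕ} {a b : ℤ}, (labelledZeta n π u)[p]? = some (.E, a) →
      (labelledZeta n π u)[p + 1]? = some (.N, b) →
      ∀ i j : ℕ, (((labelledZeta n π u).map Prod.fst).take p).count .E + 1 = i →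
        (((labelledZeta n π u).map Prod.fst).take (p + 1)).count .N + 1 = j →
      (((j ≤ n → evalSP (dC n π u) ((n : ℤ) + 1 - j) < evalSP (dC n π u) ((n : ℤ) + 1 - i)) ∧
        (n < j → evalSP (dC n π u) ((n : ℤ) - j) < evalSP (dC n π u) ((n : ℤ) + 1 - i))) ↔
        b < a) := by
    rintro p a b h1 h2 i j rfl rfl
    obtain ⟨-, ha⟩ := evalSP_dC_of_label_E hπ u (getElem?_stepLabels h1)
    obtain ⟨hb1, hb2⟩ := evalSP_dC_of_label_N hπ u (getElem?_stepLabels h2)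
    push_cast
    rw [add_sub_add_right_eq_sub, add_sub_add_right_eq_sub, ← sub_sub, sub_right_comm, ha]
    rcases lt_or_ge ((((labelledZeta n π u).map Prod.fst).take (p + 1)).count .N) n with h | h
    · rw [hb1 h]
      exact ⟨fun H => H.1 h, fun H => ⟨fun _ => H, fun h' => by omega⟩⟩
    · rw [hb2 h]
      exact ⟨fun H => H.2 (by omega), fun H => ⟨fun h' => by omega, fun _ => H⟩⟩
  have hend : ∀ {a : ℤ}, (labelledZeta n π u).getLast? = some (.E, a) →
      ∀ i j : ℕ, i = ((labelledZeta n π u).map Prod.fst).count .E →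
        j = ((labelledZeta n π u).map Prod.fst).count .N + 1 →
      (((j ≤ n → evalSP (dC n π u) ((n : ℤ) + 1 - j) < evalSP (dC n π u) ((n : ℤ) + 1 - i)) ∧
        (n < j → evalSP (dC n π u) ((n : ℤ) - j) < evalSP (dC n π u) ((n : ℤ) + 1 - i))) ↔
        0 < a) := by
    rintro a h i j rfl rfl
    obtain ⟨L, hL⟩ : ∃ L, labelledZeta n π u = L ++ [(Step.E, a)] :=
      List.getLast?_eq_some_iff.1 h
    have hpos : (labelledZeta n π u)[L.length]? = some (.E, a) := by simp [hL]
    have hcount : ((labelledZeta n π u).map Prod.fst).count .E =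
        (((labelledZeta n π u).map Prod.fst).take L.length).count .E + 1 := by
      simp [hL]
    obtain ⟨hlt, ha⟩ := evalSP_dC_of_label_E hπ u (getElem?_stepLabels hpos)
    have hE := length_stepLabels_E hπ u
    have hN := length_stepLabels_N hπ u
    rw [← count_map_fst] at hE hN
    have e1 : (n : ℤ) + 1 - ((labelledZeta n π u).map Prod.fst).count .E =
        n - (((labelledZeta n π u).map Prod.fst).take L.length).count .E := by omega
    have e2 : (n : ℤ) - (((labelledZeta n π u).map Prod.fst).count .N + 1 : ℕ) =
        -(n - (((labelledZeta n π u).map Prod.fst).take L.length).count .E) := by omega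
    rw [e1, e2, evalSP_neg, ha]
    constructor
    · intro H
      have := H.2 (by omega)
      omega
    · intro H
      exact ⟨fun h' => by omega, fun _ => by omega⟩
  constructor
  · intro H
    refine ⟨fun a b hab => ?_, fun a ha => ?_⟩
    · obtain ⟨p, h1, h2⟩ := pair_infix_iff.1 hab
      exact (hinner h1 h2 _ _ rfl rfl).1
        (H _ _ (Or.inl ⟨p, by simp [h1], by simp [h2], rfl, rfl⟩))
    · exact (hend ha _ _ rfl rfl).1
        (H _ _ (Or.inr ⟨by rw [List.getLast?_map, ha]; rfl, rfl, rfl⟩))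
  · rintro ⟨H1, H2⟩ i j (⟨p, h1, h2, h3, h4⟩ | ⟨h1, h2, h3⟩)
    · obtain ⟨a, ha⟩ := hget h1
      obtain ⟨b, hb⟩ := hget h2
      exact (hinner ha hb i j h3 h4).2 (H1 a b (pair_infix_iff.2 ⟨p, ha, hb⟩))
    · rw [List.getLast?_map] at h1
      obtain ⟨⟨s, a⟩, ha, rfl⟩ := Option.map_eq_some_iff.1 h1
      exact (hend ha i j h2 h3).2 (H2 a ha)

end Valleys

section ZetaPath

variable {n : ℕ} {π π' : List Step}

theorem count_E_reverse_sPlusL (l : List ℤ) (j : ℕ) :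
    (sPlusL (j : ℤ) l.reverse).count .E = (sPlusL ((j + 1 : ℕ) : ℤ) l.reverse).count .N := by
  have e : l.reverse = (l.reverse.map fun x => (x, (0 : ℤ))).map Prod.fst := by
    simp [Function.comp_def]
  rw [e, ← map_fst_labelledBlock, ← map_fst_labelledBlock, count_map_fst, count_map_fst,
    stepLabels_E_labelledBlock, stepLabels_N_labelledBlock]
  push_cast
  rfl

theorem sPlusL_areaValues_eq_nil (hπ : IsLatticePath n n π) {j : ℤ} (hj : (n : ℤ) < j) :
    sPlusL j ((doubledArea n π 0).map Prod.fst).reverse = [] := by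
  rw [sPlusL, List.filterMap_eq_nil_iff]
  intro x hx
  rw [List.mem_reverse, List.mem_map] at hx
  obtain ⟨p, hp, rfl⟩ := hx
  have := mem_doubledArea_bound hπ 0 hp
  have h1 : ¬ p.1 = j := by omega
  have h2 : ¬ p.1 = j + 1 := by omega
  simp [h1, h2]

theorem getLast?_sPlusL_areaValues (hπ : IsLatticePath n n π) {j : ℕ} (hj : 0 < j) :
    (sPlusL (j : ℤ) ((doubledArea n π 0).map Prod.fst).reverse).getLast? ≠ some .E := by
  rw [sPlusL, List.filterMap_reverse, List.getLast?_reverse]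
  refine head?_sPlusL_ne ?_ ?_
  · rw [List.isChain_map]
    exact slowChain_doubledArea hπ 0
  · intro x hx
    rw [List.head?_map, head?_doubledArea] at hx
    obtain ⟨p, hp, rfl⟩ := Option.map_eq_some_iff.1 hx
    have := head?_labelledArea_le 0 hp
    omega

theorem length_eq_count_add_count (l : List Step) : l.length = l.count .E + l.count .N := by
  induction l with
  | nil => rfl
  | cons s l ih => cases s <;> simp [ih] <;> omega

theorem isBallotPath_zetaC (hπ : IsLatticePath n n π) : IsBallotPath (2 * n) (zetaC n π) := by
  constructor
  · have hE := length_stepLabels_E hπ 0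
    have hN := length_stepLabels_N hπ 0
    rw [← count_map_fst, ← zetaC_eq] at hE hN
    rw [length_eq_count_add_count]
    omega
  · intro k
    rw [zetaC_eq 0, map_fst_labelledZeta]
    refine take_descFlatten_count_le _ (fun j => count_E_reverse_sPlusL _ j) _ _ ?_ k
    rw [sPlusL_areaValues_eq_nil hπ (by omega), List.count_nil]

theorem sPlusL_map_neg (j : ℤ) (l : List ℤ) : sPlusL j (l.map fun x => -x) =
    (sPlusL (-j - 1) l).map fun s => if s = .N then .E else .N := by
  rw [sPlusL, sPlusL, List.filterMap_map, List.map_filterMap]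
  congr 1; funext x
  simp only [Function.comp_apply]
  by_cases h1 : -x = j
  · have h2 : ¬ x = -j - 1 := by omega
    have h3 : x = -j - 1 + 1 := by omega
    simp only [if_pos h1, if_neg h2, if_pos h3]
    rfl
  · by_cases h2 : -x = j + 1
    · have h3 : x = -j - 1 := by omega
      simp only [if_neg h1, if_pos h2, if_pos h3]
      rfl
    · have h3 : ¬ x = -j - 1 := by omega
      have h4 : ¬ x = -j - 1 + 1 := by omega
      simp only [if_neg h1, if_neg h2, if_neg h3, if_neg h4]
      rfl

theorem reverse_map_fst_doubledArea : ((doubledArea n π 0).map Prod.fst).reverse =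
    ((doubledArea n π 0).map Prod.fst).map fun x => -x := by
  rw [map_fst_doubledArea]
  simp

theorem zetaC_injOn (hπ : IsLatticePath n n π) (hπ' : IsLatticePath n n π')
    (h : zetaC n π = zetaC n π') : π = π' := by
  have h0 := h
  rw [zetaC_eq 0, zetaC_eq 0, map_fst_labelledZeta, map_fst_labelledZeta] at h0
  have hcount : ∀ {π : List Step}, IsLatticePath n n π →
      (zetaC n π).count .N = (zetaC n π).count .E +
        (sPlusL ((0 : ℕ) : ℤ) ((doubledArea n π 0).map Prod.fst).reverse).count .N := by
    intro π hπ
    rw [zetaC_eq 0, map_fst_labelledZeta]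
    refine count_descFlatten _ (fun j => count_E_reverse_sPlusL _ j) _ _ ?_
    rw [sPlusL_areaValues_eq_nil hπ (by omega), List.count_nil]
  have hzero := hcount hπ
  rw [h, hcount hπ', Nat.add_left_cancel_iff] at hzero
  have hblock := descFlatten_injective _ _ (fun j => count_E_reverse_sPlusL _ j)
    (fun j => count_E_reverse_sPlusL _ j) (n + 1) 0
    (fun i hi => getLast?_sPlusL_areaValues hπ hi)
    (fun i hi => getLast?_sPlusL_areaValues hπ' hi) h0 hzero.symm
  have hnonneg : ∀ j : ℕ, sPlusL (j : ℤ) ((doubledArea n π 0).map Prod.fst).reverse =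
      sPlusL (j : ℤ) ((doubledArea n π' 0).map Prod.fst).reverse := by
    intro j
    by_cases hj : j < n + 1
    · exact hblock j (Nat.zero_le _) (by omega)
    · rw [sPlusL_areaValues_eq_nil hπ (by omega), sPlusL_areaValues_eq_nil hπ' (by omega)]
  have hfwd : ∀ j : ℕ, sPlusL (j : ℤ) ((doubledArea n π 0).map Prod.fst) =
      sPlusL (j : ℤ) ((doubledArea n π' 0).map Prod.fst) := by
    intro j
    have := hnonneg j
    rw [sPlusL, sPlusL, List.filterMap_reverse, List.filterMap_reverse] at this
    exact List.reverse_injective this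
  have hall : ∀ j : ℤ, sPlusL j ((doubledArea n π 0).map Prod.fst).reverse =
      sPlusL j ((doubledArea n π' 0).map Prod.fst).reverse := by
    intro j
    by_cases hj : 0 ≤ j
    · have := hnonneg j.toNat
      rwa [Int.toNat_of_nonneg hj] at this
    · have := hfwd (-j - 1).toNat
      rw [Int.toNat_of_nonneg (by omega)] at this
      rw [reverse_map_fst_doubledArea, reverse_map_fst_doubledArea, sPlusL_map_neg,
        sPlusL_map_neg, this]
  have hvalues : (doubledArea n π 0).map Prod.fst = (doubledArea n π' 0).map Prod.fst := by
    refine eq_of_sPlusL_eq ?_ ?_ fun j => ?_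
    · rw [List.isChain_map]
      exact slowChain_doubledArea hπ 0
    · rw [List.isChain_map]
      exact slowChain_doubledArea hπ' 0
    · have := hall j
      rw [sPlusL, sPlusL, List.filterMap_reverse, List.filterMap_reverse] at this
      exact List.reverse_injective this
  rw [doubledArea, doubledArea, List.map_append, List.map_append] at hvalues
  have harea := (List.append_inj hvalues (by simp [labelledArea])).1
  refine eq_of_ebn_eq (hπ.2.trans hπ'.2.symm) (hπ.1.trans hπ'.1.symm) fun k hk hk' => ?_
  rw [hπ.2] at hk'
  obtain ⟨i, rfl⟩ := Nat.exists_eq_add_of_le' hk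
  have h1 := congrArg (·[i]?) harea
  simp only [List.getElem?_map] at h1
  rw [(getElem?_labelledArea 0 i _).2 ⟨hk', rfl⟩,
    (getElem?_labelledArea 0 i _).2 ⟨hk', rfl⟩] at h1
  simp only [Option.map_some, Option.some.injEq] at h1
  omega

end ZetaPath

section Counting

instance : Finite Step :=
  Finite.of_injective (fun s => decide (s = .N)) fun s t h => by cases s <;> cases t <;> simp_all

/-- The words of length `m` that stay weakly above height zero when started at height `h`. -/
def stayingWords (m : ℕ) (h : ℤ) : Set (List Step) :=
  {l | l.length = m ∧ ∀ k, ((l.take k).count .E : ℤ) ≤ (l.take k).count .N + h}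

/-- The words of length `m` whose total displacement lies between `a` and `b`. -/
def wordsEndingIn (m : ℕ) (a b : ℤ) : Set (List Step) :=
  {l | l.length = m ∧ a ≤ (l.count .N : ℤ) - l.count .E ∧ (l.count .N : ℤ) - l.count .E ≤ b}

theorem finite_stayingWords (m : ℕ) (h : ℤ) : (stayingWords m h).Finite :=
  (List.finite_length_eq Step m).subset fun _ hl => hl.1

theorem finite_wordsEndingIn (m : ℕ) (a b : ℤ) : (wordsEndingIn m a b).Finite :=
  (List.finite_length_eq Step m).subset fun _ hl => hl.1

theorem ncard_union_cons {S T : Set (List Step)} (hS : S.Finite) (hT : T.Finite) :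
    (List.cons .N '' S ∪ List.cons .E '' T).ncard = S.ncard + T.ncard := by
  rw [Set.ncard_union_eq ?_ (hS.image _) (hT.image _),
    Set.ncard_image_of_injective _ List.cons_injective,
    Set.ncard_image_of_injective _ List.cons_injective]
  rw [Set.disjoint_left]
  rintro _ ⟨l, -, rfl⟩ ⟨l', -, h⟩
  simp at h

theorem stayingWords_succ (m : ℕ) {h : ℤ} (hh : 0 ≤ h) : stayingWords (m + 1) h =
    List.cons .N '' stayingWords m (h + 1) ∪ List.cons .E '' stayingWords m (h - 1) := by
  ext l
  simp only [stayingWords, Set.mem_union, Set.mem_image, Set.mem_ofPred_eq]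
  constructor
  · rintro ⟨h1, h2⟩
    obtain _ | ⟨s, l⟩ := l
    · simp at h1
    · cases s
      · refine Or.inl ⟨l, ⟨by simpa using h1, fun k => ?_⟩, rfl⟩
        have := h2 (k + 1)
        simp at this
        omega
      · refine Or.inr ⟨l, ⟨by simpa using h1, fun k => ?_⟩, rfl⟩
        have := h2 (k + 1)
        simp at this
        omega
  · rintro (⟨l, ⟨h1, h2⟩, rfl⟩ | ⟨l, ⟨h1, h2⟩, rfl⟩)
    · refine ⟨by simpa using h1, fun k => ?_⟩
      rcases k with _ | k
      · simpa using hh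
      · have := h2 k
        simp
        omega
    · refine ⟨by simpa using h1, fun k => ?_⟩
      rcases k with _ | k
      · simpa using hh
      · have := h2 k
        simp
        omega

theorem wordsEndingIn_succ (m : ℕ) (a b : ℤ) : wordsEndingIn (m + 1) a b =
    List.cons .N '' wordsEndingIn m (a - 1) (b - 1) ∪
      List.cons .E '' wordsEndingIn m (a + 1) (b + 1) := by
  ext l
  simp only [wordsEndingIn, Set.mem_union, Set.mem_image, Set.mem_ofPred_eq]
  constructor
  · rintro ⟨h1, h2⟩
    obtain _ | ⟨s, l⟩ := l
    · simp at h1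
    · cases s
      · refine Or.inl ⟨l, ⟨by simpa using h1, ?_⟩, rfl⟩
        simp at h2
        omega
      · refine Or.inr ⟨l, ⟨by simpa using h1, ?_⟩, rfl⟩
        simp at h2
        omega
  · rintro (⟨l, ⟨h1, h2⟩, rfl⟩ | ⟨l, ⟨h1, h2⟩, rfl⟩)
    · refine ⟨by simpa using h1, ?_⟩
      simp
      omega
    · refine ⟨by simpa using h1, ?_⟩
      simp
      omega

theorem ncard_stayingWords (m : ℕ) {h : ℤ} (hh : -1 ≤ h) :
    (stayingWords m h).ncard = (wordsEndingIn m (-h) (h + 1)).ncard := by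
  rcases hh.eq_or_lt with rfl | hh
  · have e1 : stayingWords m (-1) = ∅ := by
      refine Set.eq_empty_of_forall_notMem fun l hl => ?_
      simpa using hl.2 0
    have e2 : wordsEndingIn m (- -1) (-1 + 1) = ∅ := by
      refine Set.eq_empty_of_forall_notMem fun l hl => ?_
      have := hl.2
      omega
    rw [e1, e2]
  have hh' : 0 ≤ h := by omega
  induction m generalizing h with
  | zero =>
    congr 1
    ext l
    simp only [stayingWords, wordsEndingIn, Set.mem_ofPred_eq, List.length_eq_zero_iff]
    refine and_congr_right ?_
    rintro rfl
    simp [hh']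
    omega
  | succ m ih =>
    have hpred : (stayingWords m (h - 1)).ncard =
        (wordsEndingIn m (-h + 1) h).ncard := by
      rcases hh'.eq_or_lt with rfl | h0
      · have e1 : stayingWords m (0 - 1) = ∅ := by
          refine Set.eq_empty_of_forall_notMem fun l hl => ?_
          simpa using hl.2 0
        have e2 : wordsEndingIn m (-0 + 1) 0 = ∅ := by
          refine Set.eq_empty_of_forall_notMem fun l hl => ?_
          have := hl.2
          omega
        rw [e1, e2]
      · rw [ih (by omega) (by omega) (by omega), neg_sub, sub_add_cancel, sub_eq_neg_add]
    rw [stayingWords_succ m hh', wordsEndingIn_succ,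
      ncard_union_cons (finite_stayingWords _ _) (finite_stayingWords _ _),
      ncard_union_cons (finite_wordsEndingIn _ _ _) (finite_wordsEndingIn _ _ _),
      hpred, ih (by omega) (by omega) (by omega),
      ← Set.ncard_union_add_ncard_inter (wordsEndingIn m (-h - 1) (h + 1 - 1))
        (wordsEndingIn m (-h + 1) (h + 1 + 1))
        (finite_wordsEndingIn _ _ _) (finite_wordsEndingIn _ _ _)]
    congr 2 <;> ext l <;>
      simp only [wordsEndingIn, Set.mem_union, Set.mem_inter_iff, Set.mem_ofPred_eq] <;> omega

theorem ncard_latticePaths_eq_ncard_ballotPaths (n : ℕ) :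
    {π | IsLatticePath n n π}.ncard = {β | IsBallotPath (2 * n) β}.ncard := by
  have e1 : {π | IsLatticePath n n π} = wordsEndingIn (2 * n) (-0) (0 + 1) := by
    ext l
    have := length_eq_count_add_count l
    simp only [IsLatticePath, wordsEndingIn, Set.mem_ofPred_eq]
    omega
  have e2 : {β | IsBallotPath (2 * n) β} = stayingWords (2 * n) 0 := by
    ext l
    simp [IsBallotPath, stayingWords]
  rw [e1, e2, ncard_stayingWords _ (by omega)]

theorem zetaC_surjective {n : ℕ} {β : List Step} (hβ : IsBallotPath (2 * n) β) :
    ∃ π, IsLatticePath n n π ∧ zetaC n π = β := by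
  have hfin : {β | IsBallotPath (2 * n) β}.Finite :=
    (List.finite_length_eq Step (2 * n)).subset fun _ hl => hl.1
  have himage : zetaC n '' {π | IsLatticePath n n π} = {β | IsBallotPath (2 * n) β} := by
    refine Set.eq_of_subset_of_ncard_le ?_ ?_ hfin
    · rintro _ ⟨π, hπ, rfl⟩
      exact isBallotPath_zetaC hπ
    · have hinj : Set.InjOn (zetaC n) {π | IsLatticePath n n π} :=
        fun π hπ π' hπ' h => zetaC_injOn hπ hπ' h
      rw [hinj.ncard_image, ncard_latticePaths_eq_ncard_ballotPaths]
  have : β ∈ zetaC n '' {π | IsLatticePath n n π} := himage ▸ hβ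
  exact this

end Counting

theorem mem_DiagC_iff_mem_VertC {n : ℕ} (hn : 1 ≤ n) {π : List Step}
    (hπ : IsLatticePath n n π) (u : Fin n → ℤ) :
    (zetaC n π, dC n π u) ∈ DiagC n ↔ (π, u) ∈ VertC n := by
  have h := (valley_condition_iff hπ u).trans
    ((labelledZeta_condition_iff hπ u).trans (vertical_condition_iff hn hπ u).symm)
  simp only [DiagC, VertC, Set.mem_ofPred_eq]
  rw [isSignedPerm_dC_iff hπ, h]
  simp only [isBallotPath_zetaC hπ, hπ, true_and]

/-- The Haglund–Loehr zeta map of type `Cₙ` is a bijection from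
`Vert(Cₙ)` onto `Diag(Cₙ)`. -/
theorem HLzetaC_bijOn (n : ℕ) (hn : 1 ≤ n) :
    Set.BijOn (fun p : List Step × (Fin n → ℤ) => (zetaC n p.1, dC n p.1 p.2))
      (VertC n) (DiagC n) := by
  refine ⟨?_, ?_, ?_⟩
  · rintro ⟨π, u⟩ h
    exact (mem_DiagC_iff_mem_VertC hn h.1 u).2 h
  · rintro ⟨π, u⟩ h ⟨π', u'⟩ h' he
    simp only [Prod.mk.injEq] at he
    obtain rfl := zetaC_injOn h.1 h'.1 he.1
    rw [(dC_bijective h.1).1 he.2]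
  · rintro ⟨β, w⟩ h
    obtain ⟨π, hπ, rfl⟩ := zetaC_surjective h.1
    obtain ⟨u, rfl⟩ := (dC_bijective hπ).2 w
    exact ⟨(π, u), (mem_DiagC_iff_mem_VertC hn hπ u).1 h, rfl⟩
end
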